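/- arXiv:2110.04688 — 8 statements merged into one kernel-verified Lean document; each statement's English description precedes it below -/
import Mathlib

section
/- Assume (A1)–(A3). Fix σ̄ > σ_D and let 0 < R₁ < R₂. If σ₁ and σ₂ are the solutions of the stationary radial nutrient problem with boundary parameter σ̄ and radii R₁ and R₂ respectively, then (1/R₁³)[∫_{{σ₁ > σ_D}} g(σ₁(r)) r² dr − ν ∫_{{σ₁ ≤ σ_D}} r² dr] > (1/R₂³)[∫_{{σ₂ > σ_D}} g(σ₂(r)) r² dr − ν ∫_{{σ₂ ≤ σ_D}} r² dr]; that is, the growth average G(σ̄, R) is strictly decreasing in R for R > 0. -/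
open MeasureTheory Set Filter Topology

/-- Heaviside function: `H s = 1` for `s > 0`, `H s = 0` for `s ≤ 0`. -/
noncomputable def Hside (s : ℝ) : ℝ := if 0 < s then 1 else 0

/-- `f ∈ C¹[0,∞)` is strictly increasing. -/
def C1StrictInc (f : ℝ → ℝ) : Prop :=
  ContDiffOn ℝ 1 f (Ici 0) ∧ StrictMonoOn f (Ici 0)

/-- A solution of the stationary radial nutrient problem with boundary parameter
`σbar` and radius `R`: `σ` is continuous on `[0,R]`, differentiable on `(0,R]`
with derivative `σ'` there, satisfies
`r² σ'(r) = ∫₀^r l² f(σ l) H(σ l − σD) dl` on `(0,R]` (encoding the ODE together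
with `σ'(0) = 0`), and the Robin condition `σ'(R) + β (σ(R) − σbar) = 0`. -/
structure IsStationarySol (f : ℝ → ℝ) (β σD σbar R : ℝ) (σ σ' : ℝ → ℝ) : Prop where
  cont : ContinuousOn σ (Icc 0 R)
  deriv : ∀ r ∈ Ioc (0:ℝ) R, HasDerivWithinAt σ (σ' r) (Icc 0 R) r
  ode : ∀ r ∈ Ioc (0:ℝ) R,
    r ^ 2 * σ' r = ∫ l in (0:ℝ)..r, l ^ 2 * f (σ l) * Hside (σ l - σD)
  robin : σ' R + β * (σ R - σbar) = 0

/-- Proliferation rate `S`: `S s = g s` if `s > σD`, `S s = -ν` otherwise. -/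
noncomputable def Sfun (g : ℝ → ℝ) (σD ν s : ℝ) : ℝ := if σD < s then g s else -ν

/-- The growth average
`G = (1/R³)[∫_{r ∈ [0,R] : σ r > σD} g(σ r) r² dr − ν ∫_{r ∈ [0,R] : σ r ≤ σD} r² dr]`
associated with a radial nutrient profile `σ` on `[0,R]`. -/
noncomputable def Gavg (g : ℝ → ℝ) (σD ν R : ℝ) (σ : ℝ → ℝ) : ℝ :=
  (1 / R ^ 3) *
    ((∫ r in {r : ℝ | r ∈ Icc (0:ℝ) R ∧ σD < σ r}, g (σ r) * r ^ 2) -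
      ν * ∫ r in {r : ℝ | r ∈ Icc (0:ℝ) R ∧ σ r ≤ σD}, r ^ 2)

lemma aux_max (R : ℝ) (w P : ℝ → ℝ) (hw : ContinuousOn w (Icc 0 R))
    (hd : ∀ s ∈ Ioc (0:ℝ) R, HasDerivWithinAt w (P s / s ^ 2) (Icc 0 R) s)
    (hP0 : P 0 = 0)
    (hP : ∀ a b, 0 ≤ a → a ≤ b → b ≤ R → (∀ x ∈ Icc a b, w x < 0) → P b ≤ P a)
    (hex : ∃ s ∈ Icc (0:ℝ) R, w s < 0) : w R < 0 ∧ P R ≤ 0 := by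
  obtain ⟨s, hs, hws⟩ := hex
  obtain ⟨s0, hs0, hmin⟩ := isCompact_Icc.exists_isMinOn ⟨s, hs⟩ hw
  have hw0 : w s0 < 0 := lt_of_le_of_lt (hmin hs) hws
  have hPs0 : P s0 ≤ 0 := by
    rcases hs0.1.eq_or_lt with h | h
    · rw [← h, hP0]
    · have h1 := hd s0 ⟨h, hs0.2⟩
      have h2 : HasDerivWithinAt w (P s0 / s0 ^ 2) (Ioo 0 s0) s0 :=
        h1.mono (fun x hx => ⟨hx.1.le, hx.2.le.trans hs0.2⟩)
      rw [hasDerivWithinAt_iff_tendsto_slope' (by simp)] at h2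
      have hne : (𝓝[Ioo 0 s0] s0).NeBot := by
        rw [← mem_closure_iff_nhdsWithin_neBot, closure_Ioo h.ne]
        exact ⟨h.le, le_rfl⟩
      have h3 : P s0 / s0 ^ 2 ≤ 0 := by
        refine le_of_tendsto h2 ?_
        filter_upwards [self_mem_nhdsWithin] with x hx
        have hm : w s0 ≤ w x := hmin ⟨hx.1.le, hx.2.le.trans hs0.2⟩
        rw [slope_def_field]
        exact div_nonpos_of_nonneg_of_nonpos (by linarith) (by linarith [hx.2])
      by_contra hc
      push Not at hc
      have : 0 < P s0 / s0 ^ 2 := by positivity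
      linarith
  have key : ∀ x ∈ Icc s0 R, w x < 0 := by
    by_contra hcon
    push Not at hcon
    obtain ⟨x, hx, hwx⟩ := hcon
    have hws0 : ContinuousOn w (Icc s0 R) := hw.mono (Icc_subset_Icc_left hs0.1)
    have hcl : IsCompact (Icc s0 R ∩ w ⁻¹' Ici 0) :=
      isCompact_Icc.of_isClosed_subset
        (hws0.preimage_isClosed_of_isClosed isClosed_Icc isClosed_Ici) inter_subset_left
    obtain ⟨c, hc, hcmin⟩ := hcl.exists_isLeast ⟨x, hx, hwx⟩
    have hneg : ∀ y, s0 ≤ y → y < c → w y < 0 := by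
      intro y hy hyc
      by_contra hh
      push Not at hh
      exact absurd (hcmin ⟨⟨hy, hyc.le.trans hc.1.2⟩, hh⟩) (not_le.mpr hyc)
    have hanti : AntitoneOn w (Icc s0 c) := by
      have hder : ∀ y ∈ Ioo s0 c, HasDerivAt w (P y / y ^ 2) y := by
        intro y hy
        have := hd y ⟨hs0.1.trans_lt hy.1, hy.2.le.trans hc.1.2⟩
        exact this.hasDerivAt (Icc_mem_nhds (hs0.1.trans_lt hy.1) (hy.2.trans_le hc.1.2))
      refine antitoneOn_of_deriv_nonpos (convex_Icc _ _)
        (hws0.mono (Icc_subset_Icc_right hc.1.2)) ?_ ?_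
      · intro y hy
        rw [interior_Icc] at hy
        exact (hder y hy).differentiableAt.differentiableWithinAt
      · intro y hy
        rw [interior_Icc] at hy
        rw [(hder y hy).deriv]
        have := hP s0 y hs0.1 hy.1.le (hy.2.le.trans hc.1.2)
          (fun z hz => hneg z hz.1 (hz.2.trans_lt hy.2))
        exact div_nonpos_of_nonpos_of_nonneg (by linarith) (by positivity)
    have h1 := hanti ⟨le_rfl, hc.1.1⟩ ⟨hc.1.1, le_rfl⟩ hc.1.1
    have h2 : 0 ≤ w c := hc.2
    linarith
  exact ⟨key R ⟨hs0.2, le_rfl⟩, (hP s0 R hs0.1 hs0.2 le_rfl key).trans hPs0⟩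

lemma aux_int (k σ ρ : ℝ → ℝ) (hk : Monotone k) (a b : ℝ) (hσ : ContinuousOn σ (Icc a b))
    (hρ : ContinuousOn ρ (Icc a b)) :
    IntegrableOn (fun l => k (σ l) * ρ l) (Icc a b) := by
  refine IntegrableOn.mul_continuousOn ?_ hρ isCompact_Icc
  obtain ⟨A, hA⟩ := (isCompact_Icc.image_of_continuousOn hσ).bddAbove
  obtain ⟨B, hB⟩ := (isCompact_Icc.image_of_continuousOn hσ).bddBelow
  refine IntegrableOn.of_bound (C := max |k B| |k A|) (by simp) ?_ ?_
  · exact (hk.measurable.comp_aemeasurable (hσ.aemeasurable measurableSet_Icc)).aestronglyMeasurable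
  · refine (ae_restrict_iff' measurableSet_Icc).mpr (Eventually.of_forall fun x hx => ?_)
    rw [Real.norm_eq_abs]
    exact abs_le_max_abs_abs (hk (hB ⟨x, hx, rfl⟩)) (hk (hA ⟨x, hx, rfl⟩))

lemma aux_iint (k σ ρ : ℝ → ℝ) (hk : Monotone k) (a b : ℝ) (hσ : ContinuousOn σ (Icc a b))
    (hρ : Continuous ρ) (x y : ℝ) (hx : x ∈ Icc a b) (hy : y ∈ Icc a b) :
    IntervalIntegrable (fun l => k (σ l) * ρ l) volume x y := by
  refine IntegrableOn.intervalIntegrable ?_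
  exact (aux_int k σ ρ hk a b hσ hρ.continuousOn).mono_set (uIcc_subset_Icc hx hy)

lemma aux_G (g : ℝ → ℝ) (σD ν R : ℝ) (hR : 0 < R) (σ : ℝ → ℝ) (hσ : ContinuousOn σ (Icc 0 R))
    (hS : Monotone (Sfun g σD ν)) :
    Gavg g σD ν R σ = (1 / R ^ 3) * ∫ r in (0:ℝ)..R, Sfun g σD ν (σ r) * r ^ 2 := by
  unfold Gavg
  congr 1
  have hcl : IsClosed (Icc 0 R ∩ σ ⁻¹' Iic σD) :=
    hσ.preimage_isClosed_of_isClosed isClosed_Icc isClosed_Iic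
  have e1 : {r : ℝ | r ∈ Icc (0:ℝ) R ∧ σ r ≤ σD} = Icc 0 R ∩ σ ⁻¹' Iic σD := rfl
  have e2 : {r : ℝ | r ∈ Icc (0:ℝ) R ∧ σD < σ r} = Icc 0 R \ (Icc 0 R ∩ σ ⁻¹' Iic σD) := by
    ext x
    simp only [mem_setOf_eq, mem_diff, mem_inter_iff, mem_preimage, mem_Iic, not_and, not_le]
    tauto
  have hm := hcl.measurableSet
  have hint := aux_int (Sfun g σD ν) σ (fun r => r ^ 2) hS 0 R hσ (by fun_prop)
  rw [intervalIntegral.integral_of_le hR.le, ← integral_Icc_eq_integral_Ioc,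
    ← integral_inter_add_diff (s := Icc 0 R) hm hint, e1, e2,
    inter_eq_self_of_subset_right inter_subset_left]
  have h1 : ∫ r in Icc 0 R ∩ σ ⁻¹' Iic σD, Sfun g σD ν (σ r) * r ^ 2
      = ∫ r in Icc 0 R ∩ σ ⁻¹' Iic σD, -ν * r ^ 2 := by
    refine setIntegral_congr_fun hm fun x hx => ?_
    have : ¬ σD < σ x := not_lt.mpr hx.2
    simp [Sfun, this]
  have h2 : ∫ r in Icc 0 R \ (Icc 0 R ∩ σ ⁻¹' Iic σD), Sfun g σD ν (σ r) * r ^ 2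
      = ∫ r in Icc 0 R \ (Icc 0 R ∩ σ ⁻¹' Iic σD), g (σ r) * r ^ 2 := by
    refine setIntegral_congr_fun (measurableSet_Icc.diff hm) fun x hx => ?_
    rw [← e2] at hx
    simp [Sfun, hx.2]
  rw [h1, h2, integral_const_mul]
  ring

/-- Abstract form of the solution property. -/
structure ASol (h : ℝ → ℝ) (β σbar R : ℝ) (σ σ' : ℝ → ℝ) : Prop where
  cont : ContinuousOn σ (Icc 0 R)
  deriv : ∀ r ∈ Ioc (0:ℝ) R, HasDerivWithinAt σ (σ' r) (Icc 0 R) r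
  ode : ∀ r ∈ Ioc (0:ℝ) R, r ^ 2 * σ' r = ∫ l in (0:ℝ)..r, h (σ l) * l ^ 2
  robin : σ' R + β * (σ R - σbar) = 0

lemma aux_end (h : ℝ → ℝ) (hnn : ∀ s, 0 ≤ h s) (β σD σbar R : ℝ) (hβ : 0 < β) (hR : 0 < R)
    (h0 : ∀ s ≤ σD, h s = 0) (hσbar : σD < σbar) (σ σ' : ℝ → ℝ)
    (hs : ASol h β σbar R σ σ') : σD < σ R := by
  by_contra hc
  push Not at hc
  have hmono : MonotoneOn σ (Icc 0 R) := by
    have hder : ∀ y ∈ Ioo 0 R, HasDerivAt σ (σ' y) y := fun y hy =>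
      (hs.deriv y ⟨hy.1, hy.2.le⟩).hasDerivAt (Icc_mem_nhds hy.1 hy.2)
    refine monotoneOn_of_deriv_nonneg (convex_Icc _ _) hs.cont ?_ ?_
    · intro y hy
      rw [interior_Icc] at hy
      exact (hder y hy).differentiableAt.differentiableWithinAt
    · intro y hy
      rw [interior_Icc] at hy
      rw [(hder y hy).deriv]
      have h1 := hs.ode y ⟨hy.1, hy.2.le⟩
      have h2 : 0 ≤ ∫ l in (0:ℝ)..y, h (σ l) * l ^ 2 :=
        intervalIntegral.integral_nonneg hy.1.le fun l _ => mul_nonneg (hnn _) (by positivity)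
      rw [← h1] at h2
      exact nonneg_of_mul_nonneg_right h2 (pow_pos hy.1 2)
  have h1 := hs.ode R ⟨hR, le_rfl⟩
  have h2 : ∫ l in (0:ℝ)..R, h (σ l) * l ^ 2 = ∫ l in (0:ℝ)..R, (0:ℝ) := by
    refine intervalIntegral.integral_congr fun l hl => ?_
    rw [uIcc_of_le hR.le] at hl
    have := hmono hl ⟨hR.le, le_rfl⟩ hl.2
    simp [h0 _ (this.trans hc)]
  rw [h2] at h1
  have h3 : σ' R = 0 := by
    have : R ^ 2 ≠ 0 := by positivity
    simpa [this, hR.ne'] using h1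
  have := hs.robin
  rw [h3] at this
  nlinarith

lemma aux_shift (h : ℝ → ℝ) (hm : Monotone h) (hnn : ∀ s, 0 ≤ h s) (β σbar R₁ R₂ : ℝ)
    (hβ : 0 < β) (hR₁ : 0 < R₁) (hR : R₁ < R₂) (σ₁ σ₁' σ₂ σ₂' : ℝ → ℝ)
    (s1 : ASol h β σbar R₁ σ₁ σ₁') (s2 : ASol h β σbar R₂ σ₂ σ₂') : σ₂ R₂ ≤ σ₁ R₁ := by
  by_contra hc
  push Not at hc
  obtain ⟨D, hD, rfl⟩ : ∃ D, 0 < D ∧ R₂ = R₁ + D := ⟨R₂ - R₁, by linarith, by ring⟩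
  have hmaps : MapsTo (fun r : ℝ => r + D) (Icc 0 R₁) (Icc 0 (R₁ + D)) :=
    fun x hx => ⟨by linarith [hx.1], by linarith [hx.2]⟩
  have hτ : ContinuousOn (fun r => σ₂ (r + D)) (Icc 0 R₁) :=
    s2.cont.comp (by fun_prop) hmaps
  set M1 : ℝ → ℝ := fun r => ∫ l in (0:ℝ)..r, h (σ₁ l) * l ^ 2 with hM1
  set M2 : ℝ → ℝ := fun r => ∫ l in (0:ℝ)..r, h (σ₂ l) * l ^ 2 with hM2
  have key := aux_max R₁ (fun r => σ₁ r - σ₂ (r + D))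
    (fun r => M1 r - (r / (r + D)) ^ 2 * M2 (r + D)) (s1.cont.sub hτ) ?_ (by simp [hM1]) ?_
    ⟨R₁, ⟨hR₁.le, le_rfl⟩, by simpa using hc⟩
  · obtain ⟨-, k2⟩ := key
    have o1 : R₁ ^ 2 * σ₁' R₁ = M1 R₁ := s1.ode R₁ ⟨hR₁, le_rfl⟩
    have o2 : (R₁ + D) ^ 2 * σ₂' (R₁ + D) = M2 (R₁ + D) := s2.ode (R₁ + D) ⟨by linarith, le_rfl⟩
    try simp only at k2
    rw [← o1, ← o2] at k2
    have : R₁ + D ≠ 0 := by positivity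
    have e : (R₁ / (R₁ + D)) ^ 2 * ((R₁ + D) ^ 2 * σ₂' (R₁ + D)) = R₁ ^ 2 * σ₂' (R₁ + D) := by
      field_simp
    rw [e, ← mul_sub] at k2
    have r1 := s1.robin
    have r2 := s2.robin
    have k3 : 0 < σ₁' R₁ - σ₂' (R₁ + D) := by
      have : σ₁' R₁ - σ₂' (R₁ + D) = β * (σ₂ (R₁ + D) - σ₁ R₁) := by linarith
      rw [this]
      exact mul_pos hβ (by linarith)
    have : 0 < R₁ ^ 2 * (σ₁' R₁ - σ₂' (R₁ + D)) := by positivity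
    linarith
  · intro r hr
    have hr0 := hr.1
    have d1 := s1.deriv r hr
    have d2 := s2.deriv (r + D) ⟨by linarith [hr.1], by linarith [hr.2]⟩
    have d3 : HasDerivWithinAt (fun r : ℝ => r + D) 1 (Icc 0 R₁) r :=
      ((hasDerivAt_id r).add_const D).hasDerivWithinAt
    have d4 := d1.sub (d2.comp r d3 hmaps)
    have o1 : r ^ 2 * σ₁' r = M1 r := s1.ode r hr
    have o2 : (r + D) ^ 2 * σ₂' (r + D) = M2 (r + D) :=
      s2.ode (r + D) ⟨by linarith [hr.1], by linarith [hr.2]⟩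
    have e : (M1 r - (r / (r + D)) ^ 2 * M2 (r + D)) / r ^ 2 = σ₁' r - σ₂' (r + D) * 1 := by
      rw [← o1, ← o2]
      have : r + D ≠ 0 := by positivity
      field_simp
    try simp only
    rw [e]
    exact d4
  · intro a b ha hab hb hneg
    try simp only
    have hD' := hD
    have ea : (0:ℝ) < a + D := by linarith
    have eb : (0:ℝ) < b + D := by linarith
    have hkab : a / (a + D) ≤ b / (b + D) := by
      rw [div_le_div_iff₀ ea eb]; nlinarith
    have hkab2 : (a / (a + D)) ^ 2 ≤ (b / (b + D)) ^ 2 :=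
      pow_le_pow_left₀ (by positivity) hkab 2
    have hM2n : 0 ≤ M2 (a + D) :=
      intervalIntegral.integral_nonneg ea.le fun l _ => mul_nonneg (hnn _) (by positivity)
    have i1 : ∀ x ∈ Icc 0 R₁, ∀ y ∈ Icc 0 R₁,
        IntervalIntegrable (fun l => h (σ₁ l) * l ^ 2) volume x y := fun x hx y hy =>
      aux_iint h σ₁ (fun l => l ^ 2) hm 0 R₁ s1.cont (by fun_prop) x y hx hy
    have i2 : ∀ x ∈ Icc 0 (R₁ + D), ∀ y ∈ Icc 0 (R₁ + D),
        IntervalIntegrable (fun l => h (σ₂ l) * l ^ 2) volume x y := fun x hx y hy =>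
      aux_iint h σ₂ (fun l => l ^ 2) hm 0 (R₁ + D) s2.cont (by fun_prop) x y hx hy
    have m0 : (0:ℝ) ∈ Icc 0 R₁ := ⟨le_rfl, hR₁.le⟩
    have ma : a ∈ Icc 0 R₁ := ⟨ha, hab.trans hb⟩
    have mb : b ∈ Icc 0 R₁ := ⟨ha.trans hab, hb⟩
    have m0' : (0:ℝ) ∈ Icc 0 (R₁ + D) := ⟨le_rfl, by linarith⟩
    have q1 : M1 b - M1 a = ∫ l in a..b, h (σ₁ l) * l ^ 2 :=
      intervalIntegral.integral_interval_sub_left (i1 0 m0 b mb) (i1 0 m0 a ma)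
    have q2 : M2 (b + D) - M2 (a + D) = ∫ l in (a + D)..(b + D), h (σ₂ l) * l ^ 2 :=
      intervalIntegral.integral_interval_sub_left (i2 0 m0' _ (hmaps mb)) (i2 0 m0' _ (hmaps ma))
    have q3 : ∫ l in a..b, h (σ₂ (l + D)) * (l + D) ^ 2
        = ∫ l in (a + D)..(b + D), h (σ₂ l) * l ^ 2 :=
      intervalIntegral.integral_comp_add_right (fun l => h (σ₂ l) * l ^ 2) D
    have q4 : ∫ l in a..b, h (σ₁ l) * l ^ 2 ≤
        ∫ l in a..b, (b / (b + D)) ^ 2 * (h (σ₂ (l + D)) * (l + D) ^ 2) := by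
      refine intervalIntegral.integral_mono_on hab (i1 a ma b mb) ?_ ?_
      · exact (aux_iint h (fun l => σ₂ (l + D)) (fun l => (l + D) ^ 2) hm 0 R₁ hτ (by fun_prop)
          a b ma mb).const_mul _
      · intro l hl
        have hl0 : 0 ≤ l := ha.trans hl.1
        have el : 0 < l + D := by linarith
        have z1 : h (σ₁ l) ≤ h (σ₂ (l + D)) := hm (by linarith [hneg l hl])
        have z2 : l / (l + D) ≤ b / (b + D) := by
          rw [div_le_div_iff₀ el eb]; nlinarith [hl.2]
        have z3 : l ≤ b / (b + D) * (l + D) := (div_le_iff₀ el).mp z2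
        have z4 : l ^ 2 ≤ (b / (b + D) * (l + D)) ^ 2 := pow_le_pow_left₀ hl0 z3 2
        calc h (σ₁ l) * l ^ 2 ≤ h (σ₂ (l + D)) * (b / (b + D) * (l + D)) ^ 2 :=
              mul_le_mul z1 z4 (by positivity) (hnn _)
          _ = _ := by ring
    rw [intervalIntegral.integral_const_mul, q3, ← q2, ← q1] at q4
    nlinarith [mul_le_mul_of_nonneg_right hkab2 hM2n]

lemma aux_main (h S : ℝ → ℝ) (hm : Monotone h) (hnn : ∀ s, 0 ≤ h s) (hS : Monotone S)
    (β σD σbar R₁ R₂ : ℝ)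
    (h0 : ∀ s ≤ σD, h s = 0) (hpos : ∀ s, σD < s → 0 < h s) (hσbar : σD < σbar)
    (hSs : ∀ s t, s < t → σD < t → S s < S t)
    (hβ : 0 < β) (hR₁ : 0 < R₁) (hR : R₁ < R₂) (σ₁ σ₁' σ₂ σ₂' : ℝ → ℝ)
    (s1 : ASol h β σbar R₁ σ₁ σ₁') (s2 : ASol h β σbar R₂ σ₂ σ₂') :
    (1 / R₂ ^ 3) * ∫ r in (0:ℝ)..R₂, S (σ₂ r) * r ^ 2 <
    (1 / R₁ ^ 3) * ∫ r in (0:ℝ)..R₁, S (σ₁ r) * r ^ 2 := by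
  have hle := aux_shift h hm hnn β σbar R₁ R₂ hβ hR₁ hR σ₁ σ₁' σ₂ σ₂' s1 s2
  have hend := aux_end h hnn β σD σbar R₁ hβ hR₁ h0 hσbar σ₁ σ₁' s1
  obtain ⟨c, hc, rfl⟩ : ∃ c, 1 < c ∧ R₂ = c * R₁ :=
    ⟨R₂ / R₁, (one_lt_div hR₁).mpr hR, by field_simp⟩
  have hc0 : 0 < c := by linarith
  have hmaps : MapsTo (fun r : ℝ => c * r) (Icc 0 R₁) (Icc 0 (c * R₁)) :=
    fun x hx => ⟨mul_nonneg hc0.le hx.1, mul_le_mul_of_nonneg_left hx.2 hc0.le⟩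
  set τ : ℝ → ℝ := fun r => σ₂ (c * r) with hτd
  have hτ : ContinuousOn τ (Icc 0 R₁) := s2.cont.comp (by fun_prop) hmaps
  have hresc : ∀ (k : ℝ → ℝ) (r : ℝ), ∫ l in (0:ℝ)..(c * r), k (σ₂ l) * l ^ 2
      = c ^ 3 * ∫ l in (0:ℝ)..r, k (τ l) * l ^ 2 := by
    intro k r
    have := intervalIntegral.mul_integral_comp_mul_left (a := 0) (b := r)
      (f := fun l => k (σ₂ l) * l ^ 2) c
    rw [mul_zero] at this
    rw [← this, pow_succ, mul_comm (c ^ 2) c, mul_assoc,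
      ← intervalIntegral.integral_const_mul (c ^ 2)]
    congr 2
    ext l
    simp only [hτd]
    ring
  set M1 : ℝ → ℝ := fun r => ∫ l in (0:ℝ)..r, h (σ₁ l) * l ^ 2 with hM1
  set M2 : ℝ → ℝ := fun r => ∫ l in (0:ℝ)..r, h (τ l) * l ^ 2 with hM2
  have i1 : ∀ x ∈ Icc 0 R₁, ∀ y ∈ Icc 0 R₁,
      IntervalIntegrable (fun l => h (σ₁ l) * l ^ 2) volume x y := fun x hx y hy =>
    aux_iint h σ₁ (fun l => l ^ 2) hm 0 R₁ s1.cont (by fun_prop) x y hx hy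
  have i2 : ∀ x ∈ Icc 0 R₁, ∀ y ∈ Icc 0 R₁,
      IntervalIntegrable (fun l => h (τ l) * l ^ 2) volume x y := fun x hx y hy =>
    aux_iint h τ (fun l => l ^ 2) hm 0 R₁ hτ (by fun_prop) x y hx hy
  have m0 : (0:ℝ) ∈ Icc 0 R₁ := ⟨le_rfl, hR₁.le⟩
  have q1 : ∀ a ∈ Icc 0 R₁, ∀ b ∈ Icc 0 R₁, M1 b - M1 a = ∫ l in a..b, h (σ₁ l) * l ^ 2 :=
    fun a ma b mb =>
    intervalIntegral.integral_interval_sub_left (i1 0 m0 b mb) (i1 0 m0 a ma)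
  have q2 : ∀ a ∈ Icc 0 R₁, ∀ b ∈ Icc 0 R₁, M2 b - M2 a = ∫ l in a..b, h (τ l) * l ^ 2 :=
    fun a ma b mb =>
    intervalIntegral.integral_interval_sub_left (i2 0 m0 b mb) (i2 0 m0 a ma)
  have hder : ∀ r ∈ Ioc (0:ℝ) R₁, HasDerivWithinAt (fun r => σ₁ r - τ r)
      ((M1 r - c ^ 2 * M2 r) / r ^ 2) (Icc 0 R₁) r := by
    intro r hr
    have hr0 := hr.1
    have hcr : c * r ∈ Ioc 0 (c * R₁) := ⟨by positivity, mul_le_mul_of_nonneg_left hr.2 hc0.le⟩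
    have d1 := s1.deriv r hr
    have d2 := s2.deriv (c * r) hcr
    have d3 : HasDerivWithinAt (fun r : ℝ => c * r) (c * 1) (Icc 0 R₁) r :=
      ((hasDerivAt_id r).const_mul c).hasDerivWithinAt
    have d4 := d1.sub (d2.comp r d3 hmaps)
    have o1 : r ^ 2 * σ₁' r = M1 r := s1.ode r hr
    have o2 : (c * r) ^ 2 * σ₂' (c * r) = c ^ 3 * M2 r := (s2.ode (c * r) hcr).trans (hresc h r)
    have e : (M1 r - c ^ 2 * M2 r) / r ^ 2 = σ₁' r - σ₂' (c * r) * (c * 1) := by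
      have o3 : c * (r ^ 2 * σ₂' (c * r) * c) = c * (c ^ 2 * M2 r) := by linarith
      have o4 := mul_left_cancel₀ hc0.ne' o3
      rw [← o1, ← o4]
      field_simp
    rw [e]
    exact d4
  have hcmp : ∀ r ∈ Icc 0 R₁, τ r ≤ σ₁ r := by
    by_contra hcon
    push Not at hcon
    obtain ⟨x, hx, hx2⟩ := hcon
    have key := aux_max R₁ (fun r => σ₁ r - τ r) (fun r => M1 r - c ^ 2 * M2 r)
      (s1.cont.sub hτ) hder (by simp [hM1, hM2]) ?_ ⟨x, hx, by simpa using hx2⟩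
    · have := key.1
      simp only [hτd] at this
      linarith
    · intro a b ha hab hb hneg
      try simp only
      have ma : a ∈ Icc 0 R₁ := ⟨ha, hab.trans hb⟩
      have mb : b ∈ Icc 0 R₁ := ⟨ha.trans hab, hb⟩
      have p1 := q1 a ma b mb
      have p2 := q2 a ma b mb
      have p3 : ∫ l in a..b, h (σ₁ l) * l ^ 2 ≤ ∫ l in a..b, h (τ l) * l ^ 2 := by
        refine intervalIntegral.integral_mono_on hab (i1 a ma b mb) (i2 a ma b mb) ?_
        intro l hl
        exact mul_le_mul_of_nonneg_right (hm (by linarith [hneg l hl])) (by positivity)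
      have p4 : 0 ≤ ∫ l in a..b, h (τ l) * l ^ 2 :=
        intervalIntegral.integral_nonneg hab fun l _ => mul_nonneg (hnn _) (by positivity)
      have hc2 : 0 < c ^ 2 - 1 := by nlinarith
      rw [← p1, ← p2] at p3
      rw [← p2] at p4
      linarith [mul_nonneg hc2.le p4]
  obtain ⟨s0, hs00, hs0R, hs0⟩ : ∃ s0, 0 < s0 ∧ s0 < R₁ ∧ ∀ x ∈ Ioo s0 R₁, σD < σ₁ x := by
    have hcw := s1.cont R₁ ⟨hR₁.le, le_rfl⟩
    have hev : ∀ᶠ x in 𝓝[Icc 0 R₁] R₁, σD < σ₁ x := hcw.eventually (lt_mem_nhds hend)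
    have hev2 : ∀ᶠ x in 𝓝[<] R₁, σD < σ₁ x := by
      rw [← nhdsWithin_Ioo_eq_nhdsLT hR₁]
      exact nhdsWithin_mono _ Ioo_subset_Icc_self hev
    obtain ⟨l, hl, hl2⟩ := (mem_nhdsLT_iff_exists_mem_Ico_Ioo_subset (half_lt_self hR₁)).mp hev2
    exact ⟨l, by linarith [hl.1], hl.2, fun x hx => hl2 hx⟩
  obtain ⟨x, hx, hxlt⟩ : ∃ x ∈ Ioo s0 R₁, τ x < σ₁ x := by
    by_contra hcon
    push Not at hcon
    have heq : ∀ x ∈ Ioo s0 R₁, τ x = σ₁ x := fun x hx =>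
      le_antisymm (hcmp x ⟨by linarith [hx.1], hx.2.le⟩) (hcon x hx)
    have hM : ∀ x ∈ Ioo s0 R₁, M1 x = c ^ 2 * M2 x := by
      intro x hx
      have hx0 : 0 < x := by linarith [hx.1]
      have d1 := (hder x ⟨hx0, hx.2.le⟩).hasDerivAt (Icc_mem_nhds hx0 hx.2)
      have d2 : HasDerivAt (fun r => σ₁ r - τ r) 0 x := by
        refine (hasDerivAt_const x (0:ℝ)).congr_of_eventuallyEq ?_
        filter_upwards [Ioo_mem_nhds hx.1 hx.2] with y hy
        rw [heq y hy, sub_self]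
      have := d1.unique d2
      rw [div_eq_zero_iff] at this
      rcases this with h | h
      · linarith
      · exact absurd h (by positivity)
    obtain ⟨a, ha1, ha2⟩ := exists_between hs0R
    obtain ⟨b, hb1, hb2⟩ := exists_between ha2
    have ma : a ∈ Icc 0 R₁ := ⟨by linarith, by linarith⟩
    have mb : b ∈ Icc 0 R₁ := ⟨by linarith, by linarith⟩
    have e1 := hM a ⟨ha1, ha2⟩
    have e2 := hM b ⟨by linarith, hb2⟩
    have p1 := q1 a ma b mb
    have p2 := q2 a ma b mb
    have p3 : ∫ l in a..b, h (τ l) * l ^ 2 = ∫ l in a..b, h (σ₁ l) * l ^ 2 := by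
      refine intervalIntegral.integral_congr fun l hl => ?_
      rw [uIcc_of_le hb1.le] at hl
      try simp only
      rw [heq l ⟨by linarith [hl.1], by linarith [hl.2]⟩]
    have p4 : 0 < ∫ l in a..b, h (σ₁ l) * l ^ 2 := by
      refine intervalIntegral.intervalIntegral_pos_of_pos_on (i1 a ma b mb) ?_ hb1
      intro l hl
      have : 0 < l := by linarith [hl.1]
      exact mul_pos (hpos _ (hs0 l ⟨by linarith [hl.1], by linarith [hl.2]⟩)) (by positivity)
    rw [p3] at p2
    rw [e1, e2, ← mul_sub, p2] at p1
    have hc2 : 0 < c ^ 2 - 1 := by nlinarith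
    linarith [mul_pos hc2 p4]
  have hfin : ∫ r in (0:ℝ)..R₁, S (τ r) * r ^ 2 < ∫ r in (0:ℝ)..R₁, S (σ₁ r) * r ^ 2 := by
    have mR : R₁ ∈ Icc 0 R₁ := ⟨hR₁.le, le_rfl⟩
    refine intervalIntegral.integral_lt_integral_of_ae_le_of_measure_setOf_lt_ne_zero hR₁.le
      (aux_iint S τ (fun l => l ^ 2) hS 0 R₁ hτ (by fun_prop) _ _ m0 mR)
      (aux_iint S σ₁ (fun l => l ^ 2) hS 0 R₁ s1.cont (by fun_prop) _ _ m0 mR) ?_ ?_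
    · refine (ae_restrict_iff' measurableSet_Ioc).mpr (Eventually.of_forall fun y hy => ?_)
      exact mul_le_mul_of_nonneg_right (hS (hcmp y ⟨hy.1.le, hy.2⟩)) (by positivity)
    · have hx0 : 0 < x := by linarith [hx.1]
      have hn : Icc 0 R₁ ∈ 𝓝 x := Icc_mem_nhds hx0 hx.2
      have hev : ∀ᶠ y in 𝓝 x, τ y < σ₁ y :=
        (hτ.continuousAt hn).eventually_lt (s1.cont.continuousAt hn) hxlt
      have hnh : {y | S (τ y) * y ^ 2 < S (σ₁ y) * y ^ 2} ∩ Ioc 0 R₁ ∈ 𝓝 x := by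
        filter_upwards [hev, Ioo_mem_nhds hx.1 hx.2] with y hy hy2
        have hy0 : 0 < y := by linarith [hy2.1]
        exact ⟨mul_lt_mul_of_pos_right (hSs _ _ hy (hs0 y hy2)) (by positivity), hy0, hy2.2.le⟩
      rw [Measure.restrict_apply' measurableSet_Ioc]
      exact (MeasureTheory.Measure.measure_pos_of_mem_nhds volume hnh).ne'
  rw [hresc S R₁]
  have e : 1 / (c * R₁) ^ 3 * (c ^ 3 * ∫ l in (0:ℝ)..R₁, S (τ l) * l ^ 2)
      = 1 / R₁ ^ 3 * ∫ l in (0:ℝ)..R₁, S (τ l) * l ^ 2 := by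
    field_simp
  rw [e]
  exact mul_lt_mul_of_pos_left hfin (by positivity)

/-- Under (A1)–(A3), for fixed $σ̄ > σ_D$ the growth average $G(σ̄,R)$ is strictly
decreasing in $R$ for $R > 0$. -/
theorem stmt_12 (β σD ν : ℝ) (hβ : 0 < β) (hσD : 0 < σD) (hν : 0 < ν)
    (f g : ℝ → ℝ) (hf : C1StrictInc f) (hf0 : f 0 = 0)
    (hg : C1StrictInc g) (hgz : ∃ σt > σD, g σt = 0) (hgν : 0 ≤ g σD + ν)
    (σbar : ℝ) (hσbar : σD < σbar) (R₁ R₂ : ℝ) (hR₁ : 0 < R₁) (hR₁₂ : R₁ < R₂)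
    (σ₁ σ₁' σ₂ σ₂' : ℝ → ℝ)
    (hsol₁ : IsStationarySol f β σD σbar R₁ σ₁ σ₁')
    (hsol₂ : IsStationarySol f β σD σbar R₂ σ₂ σ₂') :
    Gavg g σD ν R₂ σ₂ < Gavg g σD ν R₁ σ₁ := by
  have hfpos : ∀ s, σD < s → 0 < f s := fun s hs => by
    rw [← hf0]
    exact hf.2 (by simp) (mem_Ici.mpr (by linarith)) (by linarith)
  have hh0 : ∀ s ≤ σD, f s * Hside (s - σD) = 0 := fun s hs => by
    have : ¬ 0 < s - σD := by linarith
    simp only [Hside, if_neg this, mul_zero]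
  have hh1 : ∀ s, σD < s → f s * Hside (s - σD) = f s := fun s hs => by
    have : 0 < s - σD := by linarith
    simp only [Hside, if_pos this, mul_one]
  have hnn : ∀ s, 0 ≤ f s * Hside (s - σD) := fun s => by
    rcases le_or_gt s σD with hs | hs
    · rw [hh0 s hs]
    · rw [hh1 s hs]; exact (hfpos s hs).le
  have hmono : Monotone (fun s => f s * Hside (s - σD)) := fun s t hst => by
    rcases le_or_gt s σD with hs | hs
    · beta_reduce; rw [hh0 s hs]; exact hnn t
    · have ht : σD < t := by linarith
      beta_reduce; rw [hh1 s hs, hh1 t ht]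
      exact hf.2.monotoneOn (mem_Ici.mpr (by linarith)) (mem_Ici.mpr (by linarith)) hst
  have hSs : ∀ s t, s < t → σD < t → Sfun g σD ν s < Sfun g σD ν t := fun s t hst ht => by
    rcases le_or_gt s σD with hs | hs
    · have := hg.2 (mem_Ici.mpr hσD.le) (mem_Ici.mpr (by linarith)) ht
      simp only [Sfun, if_neg (not_lt.mpr hs), if_pos ht]
      linarith
    · simp only [Sfun, if_pos hs, if_pos ht]
      exact hg.2 (mem_Ici.mpr (by linarith)) (mem_Ici.mpr (by linarith)) hst
  have hS : Monotone (Sfun g σD ν) := fun s t hst => by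
    rcases hst.eq_or_lt with rfl | hst
    · exact le_rfl
    rcases le_or_gt t σD with ht | ht
    · simp only [Sfun, if_neg (not_lt.mpr ht), if_neg (not_lt.mpr (hst.le.trans ht))]
      exact le_rfl
    · exact (hSs s t hst ht).le
  have conv : ∀ R σ σ', IsStationarySol f β σD σbar R σ σ' →
      ASol (fun s => f s * Hside (s - σD)) β σbar R σ σ' := fun R σ σ' hs =>
    ⟨hs.cont, hs.deriv, fun r hr => by
      rw [hs.ode r hr]
      congr 1
      ext l
      ring, hs.robin⟩
  rw [aux_G g σD ν R₂ (by linarith) σ₂ hsol₂.cont hS, aux_G g σD ν R₁ hR₁ σ₁ hsol₁.cont hS]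
  exact aux_main (fun s => f s * Hside (s - σD)) (Sfun g σD ν) hmono hnn hS β σD σbar R₁ R₂
    hh0 (fun s hs => by rw [hh1 s hs]; exact hfpos s hs) hσbar hSs hβ hR₁ hR₁₂
    σ₁ σ₁' σ₂ σ₂' (conv _ _ _ hsol₁) (conv _ _ _ hsol₂)
end

section
/- Assume (A1)–(A3) and fix σ̄ > σ_D. Then for every ε > 0 there exists δ > 0 such that for all 0 < R < δ and every solution σ of the stationary radial nutrient problem with parameters σ̄ and R, one has |(1/R³)[∫_{{σ > σ_D}} g(σ(r)) r² dr − ν ∫_{{σ ≤ σ_D}} r² dr] − g(σ̄)/3| < ε; that is, the growth average G(σ̄, R) tends to g(σ̄)/3 as R → 0⁺. -/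
open MeasureTheory Set Filter Topology

/-- Under (A1)–(A3), for fixed $σ̄ > σ_D$ the growth average $G(σ̄,R)$ tends to
$g(σ̄)/3$ as $R → 0^+$. -/
theorem stmt_13 (β σD ν : ℝ) (hβ : 0 < β) (hσD : 0 < σD) (hν : 0 < ν)
    (f g : ℝ → ℝ) (hf : C1StrictInc f) (hf0 : f 0 = 0)
    (hg : C1StrictInc g) (hgz : ∃ σt > σD, g σt = 0) (hgν : 0 ≤ g σD + ν)
    (σbar : ℝ) (hσbar : σD < σbar) :
    ∀ ε > (0:ℝ), ∃ δ > (0:ℝ), ∀ R, 0 < R → R < δ →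
      ∀ (σ σ' : ℝ → ℝ), IsStationarySol f β σD σbar R σ σ' →
        |Gavg g σD ν R σ - g σbar / 3| < ε := by
  intro ε hε
  have hσb0 : 0 < σbar := hσD.trans hσbar
  have hgc : ContinuousWithinAt g (Ici 0) σbar := hg.1.continuousOn σbar hσb0.le
  obtain ⟨η, hη, hgη⟩ := Metric.continuousWithinAt_iff.1 hgc (ε / 2) (by positivity)
  set M := f σbar with hM
  have hMpos : 0 < M := by
    rw [← hf0]; exact hf.2 (mem_Ici.2 le_rfl) (mem_Ici.2 hσb0.le) hσb0
  set κ := min η (σbar - σD) with hκ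
  have hκpos : 0 < κ := lt_min hη (sub_pos.2 hσbar)
  refine ⟨min 1 (κ / (M / β + M)), by positivity, ?_⟩
  intro R hR hRδ σ σ' hs
  have hR1 : R < 1 := hRδ.trans_le (min_le_left _ _)
  have hRκ : R * (M / β + M) < κ := by
    have := hRδ.trans_le (min_le_right _ _)
    rwa [lt_div_iff₀ (by positivity)] at this
  have hint0 : ∀ l, 0 ≤ l ^ 2 * f (σ l) * Hside (σ l - σD) := by
    intro l
    unfold Hside
    split_ifs with h
    · have h1 : 0 < σ l := by linarith
      have : f 0 < f (σ l) := hf.2 (mem_Ici.2 le_rfl) (mem_Ici.2 h1.le) h1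
      rw [hf0] at this
      positivity
    · simp
  have hd0 : ∀ r ∈ Ioc (0:ℝ) R, 0 ≤ σ' r := by
    intro r hr
    have h1 : 0 ≤ r ^ 2 * σ' r := by
      rw [hs.ode r hr]
      exact intervalIntegral.integral_nonneg hr.1.le (fun l _ => hint0 l)
    have : 0 < r ^ 2 := pow_pos hr.1 2
    exact nonneg_of_mul_nonneg_right h1 this
  have hda : ∀ r ∈ Ioo (0:ℝ) R, HasDerivAt σ (σ' r) r := fun r hr =>
    (hs.deriv r ⟨hr.1, hr.2.le⟩).hasDerivAt (Icc_mem_nhds hr.1 hr.2)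
  have hmono : MonotoneOn σ (Icc 0 R) := by
    apply monotoneOn_of_deriv_nonneg (convex_Icc 0 R) hs.cont
    · rw [interior_Icc]
      exact fun r hr => (hda r hr).differentiableAt.differentiableWithinAt
    · rw [interior_Icc]
      intro r hr
      rw [(hda r hr).deriv]
      exact hd0 r ⟨hr.1, hr.2.le⟩
  have hRm : R ∈ Icc 0 R := ⟨hR.le, le_rfl⟩
  have hRb : σ R ≤ σbar := by
    have h1 := hd0 R ⟨hR, le_rfl⟩
    have h2 := hs.robin
    by_contra h
    push Not at h
    have := mul_pos hβ (sub_pos.2 h)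
    linarith
  have hub : ∀ r ∈ Icc 0 R, σ r ≤ σbar := fun r hr => (hmono hr hRm hr.2).trans hRb
  have hdM : ∀ r ∈ Ioc (0:ℝ) R, σ' r ≤ M * R := by
    intro r hr
    have h1 : ‖∫ l in (0:ℝ)..r, l ^ 2 * f (σ l) * Hside (σ l - σD)‖ ≤ (r ^ 2 * M) * |r - 0| := by
      apply intervalIntegral.norm_integral_le_of_norm_le_const
      intro l hl
      rw [uIoc_of_le hr.1.le] at hl
      rw [Real.norm_of_nonneg (hint0 l)]
      have hl2 : l ^ 2 ≤ r ^ 2 := pow_le_pow_left₀ hl.1.le hl.2 2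
      unfold Hside
      split_ifs with h
      · have h1 : 0 < σ l := by linarith
        have h2 : f (σ l) ≤ M := hf.2.monotoneOn (mem_Ici.2 h1.le) (mem_Ici.2 hσb0.le)
          (hub l ⟨hl.1.le, hl.2.trans hr.2⟩)
        rw [mul_one]
        exact mul_le_mul hl2 h2 (hf0 ▸ hf.2.monotoneOn (mem_Ici.2 le_rfl) (mem_Ici.2 h1.le) h1.le) (by positivity)
      · rw [mul_zero]; positivity
    rw [← hs.ode r hr, sub_zero, abs_of_pos hr.1] at h1
    have h2 : r ^ 2 * σ' r ≤ r ^ 2 * (M * r) := by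
      have := (Real.le_norm_self _).trans h1
      linarith
    have h3 := le_of_mul_le_mul_left h2 (pow_pos hr.1 2)
    exact h3.trans (mul_le_mul_of_nonneg_left hr.2 hMpos.le)
  have hlb : ∀ r ∈ Icc 0 R, σbar - κ < σ r := by
    intro r hr
    have h1 : σ R - σ r ≤ M * R * (R - r) := by
      apply (convex_Icc 0 R).image_sub_le_mul_sub_of_deriv_le hs.cont
        _ _ r hr R hRm hr.2
      · rw [interior_Icc]
        exact fun r hr => (hda r hr).differentiableAt.differentiableWithinAt
      · rw [interior_Icc]
        intro r hr
        rw [(hda r hr).deriv]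
        exact hdM r ⟨hr.1, hr.2.le⟩
    have h2 : M * R * (R - r) ≤ M * R * 1 :=
      mul_le_mul_of_nonneg_left (by linarith [hr.1]) (by positivity)
    have h3 := hdM R ⟨hR, le_rfl⟩
    have h4 : σbar - σ R ≤ M * R / β := by
      rw [le_div_iff₀ hβ]
      linarith [hs.robin]
    have h5 : R * (M / β + M) = M * R / β + M * R := by ring
    linarith
  have hD : ∀ r ∈ Icc 0 R, σD < σ r := by
    intro r hr
    have := hlb r hr
    have := min_le_right η (σbar - σD)
    linarith
  have hgd : ∀ r ∈ Icc 0 R, |g (σ r) - g σbar| < ε / 2 := by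
    intro r hr
    apply hgη (mem_Ici.2 (hσD.trans (hD r hr)).le)
    rw [Real.dist_eq, abs_lt]
    have := hlb r hr
    have := min_le_left η (σbar - σD)
    have := hub r hr
    constructor <;> linarith
  have e1 : {r : ℝ | r ∈ Icc (0:ℝ) R ∧ σD < σ r} = Icc 0 R := by
    ext r; exact ⟨fun h => h.1, fun h => ⟨h, hD r h⟩⟩
  have e2 : {r : ℝ | r ∈ Icc (0:ℝ) R ∧ σ r ≤ σD} = ∅ := by
    ext r
    simp only [mem_setOf_eq, mem_empty_iff_false, iff_false]
    exact fun h => absurd (hD r h.1) (not_lt.2 h.2)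
  have hcont : ContinuousOn (fun r => g (σ r) * r ^ 2) (Icc 0 R) := by
    apply ContinuousOn.mul _ (by fun_prop)
    exact hg.1.continuousOn.comp hs.cont (fun r hr => mem_Ici.2 (hσD.trans (hD r hr)).le)
  have hii : IntervalIntegrable (fun r => g (σ r) * r ^ 2) volume 0 R :=
    ContinuousOn.intervalIntegrable_of_Icc hR.le hcont
  have hi2 : IntervalIntegrable (fun r : ℝ => g σbar * r ^ 2) volume 0 R :=
    Continuous.intervalIntegrable (by fun_prop) _ _
  have e3 : ∫ r in (0:ℝ)..R, g σbar * r ^ 2 = g σbar * (R ^ 3 / 3) := by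
    rw [intervalIntegral.integral_const_mul, integral_pow]
    norm_num
  have hG : Gavg g σD ν R σ - g σbar / 3
      = (1 / R ^ 3) * ∫ r in (0:ℝ)..R, (g (σ r) * r ^ 2 - g σbar * r ^ 2) := by
    unfold Gavg
    rw [e1, e2, intervalIntegral.integral_sub hii hi2, e3, integral_Icc_eq_integral_Ioc,
      ← intervalIntegral.integral_of_le hR.le]
    simp only [Measure.restrict_empty, integral_zero_measure]
    field_simp
    ring
  have hb : ‖∫ r in (0:ℝ)..R, (g (σ r) * r ^ 2 - g σbar * r ^ 2)‖ ≤ (ε / 2 * R ^ 2) * |R - 0| := by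
    apply intervalIntegral.norm_integral_le_of_norm_le_const
    intro l hl
    rw [uIoc_of_le hR.le] at hl
    rw [← sub_mul, norm_mul, Real.norm_eq_abs, Real.norm_of_nonneg (sq_nonneg l)]
    exact mul_le_mul (hgd l ⟨hl.1.le, hl.2⟩).le (pow_le_pow_left₀ hl.1.le hl.2 2) (by positivity)
      (by positivity)
  rw [sub_zero, abs_of_pos hR, Real.norm_eq_abs] at hb
  rw [hG, abs_mul, abs_of_pos (by positivity : 0 < 1 / R ^ 3)]
  calc _ ≤ 1 / R ^ 3 * (ε / 2 * R ^ 2 * R) := mul_le_mul_of_nonneg_left hb (by positivity)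
    _ = ε / 2 := by field_simp
    _ < ε := by linarith
end

section
/- Let ω > 0 and let ψ : ℝ → ℝ be continuous and ω-periodic. Set S* = max_{0 ≤ t ≤ ω} ∫₀^t ψ(τ) dτ and S_* = min_{0 ≤ t ≤ ω} ∫₀^t ψ(τ) dτ, and assume ∫₀^ω ψ(τ) dτ ≤ 0. Then for every a ≥ 0 and every t with a ≤ t ≤ a + ω, one has ∫_a^t ψ(τ) dτ ≤ 2S* − S_*. -/
open MeasureTheory Set Filter Topology

/-- For a continuous `ω`-periodic `ψ` with `∫₀^ω ψ ≤ 0`, setting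
`S* = max_{0 ≤ t ≤ ω} ∫₀^t ψ` and `S_* = min_{0 ≤ t ≤ ω} ∫₀^t ψ`, one has
`∫_a^t ψ ≤ 2S* − S_*` for every `a ≥ 0` and every `t ∈ [a, a + ω]`. -/
theorem stmt_14 (ω : ℝ) (hω : 0 < ω) (ψ : ℝ → ℝ) (hc : Continuous ψ)
    (hper : Function.Periodic ψ ω)
    (Sstar Sstar' : ℝ)
    (hS : Sstar = sSup ((fun t => ∫ τ in (0:ℝ)..t, ψ τ) '' Icc 0 ω))
    (hs : Sstar' = sInf ((fun t => ∫ τ in (0:ℝ)..t, ψ τ) '' Icc 0 ω))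
    (hneg : (∫ τ in (0:ℝ)..ω, ψ τ) ≤ 0) :
    ∀ a ≥ (0:ℝ), ∀ t, a ≤ t → t ≤ a + ω →
      (∫ τ in a..t, ψ τ) ≤ 2 * Sstar - Sstar' := by
  intro a ha t hat hta
  have hFc : Continuous (fun t => ∫ τ in (0:ℝ)..t, ψ τ) :=
    intervalIntegral.continuous_primitive (fun a b => hc.intervalIntegrable a b) 0
  have hK := (isCompact_Icc (a := (0:ℝ)) (b := ω)).image hFc
  have hub : ∀ x, 0 ≤ x → x ≤ ω → (∫ τ in (0:ℝ)..x, ψ τ) ≤ Sstar := by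
    intro x h0 h1
    rw [hS]
    exact le_csSup hK.bddAbove ⟨x, ⟨h0, h1⟩, rfl⟩
  have hlb : ∀ x, 0 ≤ x → x ≤ ω → Sstar' ≤ (∫ τ in (0:ℝ)..x, ψ τ) := by
    intro x h0 h1
    rw [hs]
    exact csInf_le hK.bddBelow ⟨x, ⟨h0, h1⟩, rfl⟩
  have hS0 : 0 ≤ Sstar := by
    have := hub 0 le_rfl hω.le
    simpa using this
  have key : ∀ b u : ℝ, 0 ≤ b → b ≤ ω → b ≤ u → u ≤ b + ω →
      (∫ τ in b..u, ψ τ) ≤ 2 * Sstar - Sstar' := by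
    intro b u hb0 hb1 hbu hu
    have hsub := intervalIntegral.integral_interval_sub_left
      (hc.intervalIntegrable (μ := volume) 0 u) (hc.intervalIntegrable (μ := volume) 0 b)
    have hb := hlb b hb0 hb1
    rcases le_total u ω with h | h
    · have := hub u (hb0.trans hbu) h
      linarith
    · have h1 := hub (u - ω) (by linarith) (by linarith)
      have h2 : (∫ τ in (0:ℝ)..(u - ω), ψ τ) = ∫ τ in ω..u, ψ τ := by
        have := intervalIntegral.integral_comp_add_right (a := 0) (b := u - ω) ψ ω
        simpa [hper _] using this
      have h3 := intervalIntegral.integral_add_adjacent_intervals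
        (hc.intervalIntegrable (μ := volume) 0 ω) (hc.intervalIntegrable (μ := volume) ω u)
      linarith
  have hn0 := Int.floor_le (a / ω)
  have hn1 := (Int.lt_floor_add_one (a / ω)).le
  rw [le_div_iff₀ hω] at hn0
  rw [div_le_iff₀ hω] at hn1
  have hk := key (a - ⌊a / ω⌋ * ω) (t - ⌊a / ω⌋ * ω) (by linarith) (by linarith)
    (by linarith) (by linarith)
  have := intervalIntegral.integral_comp_add_right (a := a - ⌊a / ω⌋ * ω)
    (b := t - ⌊a / ω⌋ * ω) ψ (⌊a / ω⌋ * ω)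
  simp only [(hper.int_mul ⌊a / ω⌋) _, sub_add_cancel] at this
  rwa [this] at hk
end

section
/- Let ω > 0, let ψ : ℝ → ℝ be continuous and ω-periodic with ∫₀^ω ψ(τ) dτ ≤ 0, and set S* = max_{0 ≤ t ≤ ω} ∫₀^t ψ(τ) dτ and S_* = min_{0 ≤ t ≤ ω} ∫₀^t ψ(τ) dτ. Let G : ℝ × (0,∞) → ℝ satisfy G(t, ρ) ≤ ψ(t)/3 for all t ≥ 0 and ρ > 0, and let R : [0,∞) → (0,∞) be differentiable with R'(t) = R(t) G(t, R(t)) for all t > 0. Then for all 0 ≤ a ≤ t, R(t) ≤ R(a) e^{(2S* − S_*)/3}. -/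
open MeasureTheory Set Filter Topology

/-- Let `ψ` be continuous `ω`-periodic with `∫₀^ω ψ ≤ 0`, `S*` and `S_*` the max
and min of `t ↦ ∫₀^t ψ` over `[0,ω]`. If `G(t,ρ) ≤ ψ(t)/3` for `t ≥ 0`, `ρ > 0`,
and `R : [0,∞) → (0,∞)` is differentiable with `R' = R·G(t,R)` for `t > 0`, then
`R(t) ≤ R(a) e^{(2S* − S_*)/3}` for all `0 ≤ a ≤ t`. -/
theorem stmt_15 (ω : ℝ) (hω : 0 < ω) (ψ : ℝ → ℝ) (hc : Continuous ψ)
    (hper : Function.Periodic ψ ω)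
    (hneg : (∫ τ in (0:ℝ)..ω, ψ τ) ≤ 0)
    (Sstar Sstar' : ℝ)
    (hS : Sstar = sSup ((fun t => ∫ τ in (0:ℝ)..t, ψ τ) '' Icc 0 ω))
    (hs : Sstar' = sInf ((fun t => ∫ τ in (0:ℝ)..t, ψ τ) '' Icc 0 ω))
    (G : ℝ → ℝ → ℝ)
    (hGψ : ∀ t ≥ (0:ℝ), ∀ ρ > (0:ℝ), G t ρ ≤ ψ t / 3)
    (R : ℝ → ℝ) (hRpos : ∀ t ≥ (0:ℝ), 0 < R t)
    (hRdiff : ∀ t ≥ (0:ℝ), DifferentiableWithinAt ℝ R (Ici 0) t)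
    (hode : ∀ t > (0:ℝ), HasDerivAt R (R t * G t (R t)) t)
    (hint : ∀ a b : ℝ, IntervalIntegrable (fun t => G t (R t)) volume a b) :
    ∀ a t : ℝ, 0 ≤ a → a ≤ t →
      R t ≤ R a * Real.exp ((2 * Sstar - Sstar') / 3) := by
  intro a t ha hat
  set F : ℝ → ℝ := fun t => ∫ τ in (0:ℝ)..t, ψ τ with hF
  have hFd : ∀ x, HasDerivAt F (ψ x) x := fun x =>
    intervalIntegral.integral_hasDerivAt_right (hc.intervalIntegrable _ _)
      (hc.stronglyMeasurableAtFilter _ _) hc.continuousAt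
  have hFc : Continuous F := continuous_iff_continuousAt.2 fun x => (hFd x).continuousAt
  have hcpt : IsCompact (F '' Icc 0 ω) := isCompact_Icc.image hFc
  have hle : ∀ x ∈ Icc 0 ω, F x ≤ Sstar := fun x hx => by
    rw [hS]; exact le_csSup hcpt.bddAbove (mem_image_of_mem _ hx)
  have hge : ∀ x ∈ Icc 0 ω, Sstar' ≤ F x := fun x hx => by
    rw [hs]; exact csInf_le hcpt.bddBelow (mem_image_of_mem _ hx)
  have hF0 : F 0 = 0 := by simp [hF]
  have hS0 : 0 ≤ Sstar := by
    rw [← hF0]; exact hle 0 ⟨le_refl _, hω.le⟩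
  have hstep : ∀ x, F (x + ω) = F x + F ω := by
    intro x
    have h1 : F x + (∫ τ in x..(x + ω), ψ τ) = F (x + ω) :=
      intervalIntegral.integral_add_adjacent_intervals
        (hc.intervalIntegrable _ _) (hc.intervalIntegrable _ _)
    have h2 := hper.intervalIntegral_add_eq x 0
    rw [zero_add] at h2
    rw [← h1, h2]
  have hstepn : ∀ (n : ℕ) x, F (x + n * ω) = F x + n * F ω := by
    intro n x
    induction n with
    | zero => simp
    | succ k ih =>
      have : x + ((k + 1 : ℕ) : ℝ) * ω = (x + k * ω) + ω := by push_cast; ring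
      rw [this, hstep, ih]; push_cast; ring
  have hdec : ∀ x, 0 ≤ x → ∃ r ∈ Icc 0 ω, F x = F r + (⌊x / ω⌋₊ : ℝ) * F ω := by
    intro x hx
    refine ⟨x - ⌊x / ω⌋₊ * ω, ⟨?_, ?_⟩, ?_⟩
    · have := Nat.floor_le (div_nonneg hx hω.le)
      rw [le_div_iff₀ hω] at this
      linarith
    · have := Nat.lt_floor_add_one (x / ω)
      rw [div_lt_iff₀ hω] at this
      linarith
    · rw [← hstepn]; congr 1; ring
  have hbound : F t - F a ≤ 2 * Sstar - Sstar' := by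
    obtain ⟨r, hr, h1⟩ := hdec t (ha.trans hat)
    obtain ⟨s, hs', h2⟩ := hdec a ha
    have hmn : ((⌊a / ω⌋₊ : ℕ) : ℝ) ≤ ⌊t / ω⌋₊ := by
      exact_mod_cast Nat.floor_mono (by gcongr)
    have hI : F ω ≤ 0 := hneg
    have := hle r hr
    have := hge s hs'
    nlinarith
  have hanti : AntitoneOn (fun x => R x * Real.exp (-F x / 3)) (Ici 0) := by
    have hd : ∀ x > (0:ℝ), HasDerivAt (fun x => R x * Real.exp (-F x / 3))
        (R x * G x (R x) * Real.exp (-F x / 3)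
          + R x * (Real.exp (-F x / 3) * (-ψ x / 3))) x := fun x hx =>
      (hode x hx).mul (((hFd x).neg.div_const 3).exp)
    apply antitoneOn_of_deriv_nonpos (convex_Ici 0)
    · refine ContinuousOn.mul (fun x hx => (hRdiff x hx).continuousWithinAt) ?_
      exact (by fun_prop : Continuous fun x => Real.exp (-F x / 3)).continuousOn
    · rw [interior_Ici]
      exact fun x hx => (hd x hx).differentiableAt.differentiableWithinAt
    · rw [interior_Ici]
      intro x hx
      have hx' : (0:ℝ) < x := hx
      rw [(hd x hx).deriv]
      have hp : 0 < R x * Real.exp (-F x / 3) :=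
        mul_pos (hRpos x hx'.le) (Real.exp_pos _)
      have hg := hGψ x hx'.le (R x) (hRpos x hx'.le)
      have := mul_nonpos_of_nonneg_of_nonpos hp.le (sub_nonpos.2 hg)
      linarith
  have hA : R t * Real.exp (-F t / 3) ≤ R a * Real.exp (-F a / 3) :=
    hanti ha (ha.trans hat) hat
  calc R t = R t * Real.exp (-F t / 3) * Real.exp (F t / 3) := by
        rw [mul_assoc, ← Real.exp_add]; ring_nf; simp
    _ ≤ R a * Real.exp (-F a / 3) * Real.exp (F t / 3) := by gcongr
    _ = R a * Real.exp ((F t - F a) / 3) := by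
        rw [mul_assoc, ← Real.exp_add]; ring_nf
    _ ≤ _ := by
        have := hRpos a ha
        gcongr
end

section
/- Let ω > 0 and let G : ℝ × (0,∞) → ℝ be continuous, ω-periodic in its first variable, and nonincreasing in its second variable. Suppose there is a continuous ω-periodic ψ : ℝ → ℝ with ∫₀^ω ψ(τ) dτ ≤ 0 and G(t, ρ) ≤ ψ(t)/3 for all t and all ρ > 0, and suppose that ∫₀^ω G(t, c) dt < 0 for every c > 0. Then every differentiable R : [0,∞) → (0,∞) solving R'(t) = R(t) G(t, R(t)) satisfies lim_{t→+∞} R(t) = 0. -/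
open MeasureTheory Set Filter Topology

/-- Let `G : ℝ × (0,∞) → ℝ` be continuous, `ω`-periodic in `t`, nonincreasing
in `ρ`, dominated by `ψ(t)/3` for a continuous `ω`-periodic `ψ` with
`∫₀^ω ψ ≤ 0`, and with `∫₀^ω G(t,c) dt < 0` for every `c > 0`. Then every
positive differentiable solution of `R' = R·G(t,R)` on `[0,∞)` tends to `0`. -/
theorem stmt_16 (ω : ℝ) (hω : 0 < ω) (G : ℝ → ℝ → ℝ)
    (hGc : ContinuousOn (fun p : ℝ × ℝ => G p.1 p.2) (univ ×ˢ Ioi 0))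
    (hGper : ∀ t, ∀ ρ > (0:ℝ), G (t + ω) ρ = G t ρ)
    (hGanti : ∀ t, AntitoneOn (G t) (Ioi 0))
    (ψ : ℝ → ℝ) (hψc : Continuous ψ) (hψper : Function.Periodic ψ ω)
    (hψneg : (∫ τ in (0:ℝ)..ω, ψ τ) ≤ 0)
    (hGψ : ∀ t, ∀ ρ > (0:ℝ), G t ρ ≤ ψ t / 3)
    (hGint : ∀ c > (0:ℝ), (∫ t in (0:ℝ)..ω, G t c) < 0) :
    ∀ R : ℝ → ℝ, (∀ t ≥ (0:ℝ), 0 < R t) →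
      (∀ t ≥ (0:ℝ), HasDerivWithinAt R (R t * G t (R t)) (Ici 0) t) →
      Tendsto R atTop (nhds 0) := by
  intro R hRpos hR
  have hLd : ∀ t ≥ (0:ℝ), HasDerivWithinAt (fun x => Real.log (R x)) (G t (R t)) (Ici 0) t := by
    intro t ht
    have h := (hR t ht).log (hRpos t ht).ne'
    rwa [mul_div_cancel_left₀ _ (hRpos t ht).ne'] at h
  have key : ∀ f : ℝ → ℝ, Continuous f → ∀ s t : ℝ, 0 ≤ s → s ≤ t →
      (∀ x ∈ Icc s t, G x (R x) ≤ f x) →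
      Real.log (R t) - Real.log (R s) ≤ ∫ x in s..t, f x := by
    intro f hf s t hs hst hle
    refine intervalIntegral.sub_le_integral_of_hasDeriv_right_of_le
      (g := fun x => Real.log (R x)) (g' := fun x => G x (R x)) hst ?_ ?_ ?_ ?_
    · intro x hx
      exact ((hLd x (hs.trans hx.1)).continuousWithinAt).mono
        (fun y hy => hs.trans hy.1)
    · intro x hx
      have hx0 : 0 ≤ x := hs.trans hx.1.le
      exact (hLd x hx0).mono (fun y hy => hx0.trans (le_of_lt hy))
    · exact hf.integrableOn_Icc
    · intro x hx
      exact hle x (Ioo_subset_Icc_self hx)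
  obtain ⟨M, hM⟩ : ∃ M : ℝ, ∀ x, ψ x / 3 ≤ M := by
    obtain ⟨C, hC⟩ := isBounded_iff_forall_norm_le.1
      (hψper.isBounded_of_continuous hω.ne' hψc)
    refine ⟨C / 3, fun x => ?_⟩
    have := (le_abs_self _).trans (hC _ (mem_range_self x))
    linarith
  have hM' : ∀ x, ψ x / 3 ≤ |M| := fun x => (hM x).trans (le_abs_self M)
  have grow : ∀ s t : ℝ, 0 ≤ s → s ≤ t → t ≤ s + ω →
      Real.log (R t) ≤ Real.log (R s) + |M| * ω := by
    intro s t hs hst htω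
    have h := key (fun _ => |M|) continuous_const s t hs hst
      (fun x hx => (hGψ x _ (hRpos x (hs.trans hx.1))).trans (hM' x))
    simp only [intervalIntegral.integral_const, smul_eq_mul] at h
    have : (t - s) * |M| ≤ ω * |M| :=
      mul_le_mul_of_nonneg_right (by linarith) (abs_nonneg M)
    linarith
  have per : ∀ f : ℝ → ℝ, Function.Periodic f ω → ∀ s, (∫ x in s..(s + ω), f x) = ∫ x in (0:ℝ)..ω, f x := by
    intro f hf s
    have := hf.intervalIntegral_add_eq s 0
    rwa [zero_add] at this
  have hn0 : ∀ n : ℕ, (0:ℝ) ≤ n * ω := fun n => by positivity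
  have step : ∀ n : ℕ, Real.log (R ((n + 1 : ℕ) * ω)) ≤ Real.log (R (n * ω)) := by
    intro n
    have h := key (fun x => ψ x / 3) (by fun_prop) (n * ω) (n * ω + ω) (hn0 n) (by linarith)
      (fun x hx => hGψ x _ (hRpos x ((hn0 n).trans hx.1)))
    rw [per _ (fun x => by simp only [hψper x])] at h
    rw [intervalIntegral.integral_div] at h
    have e : ((n + 1 : ℕ) : ℝ) * ω = n * ω + ω := by push_cast; ring
    rw [e]
    linarith
  have mono : Antitone (fun n : ℕ => Real.log (R (n * ω))) := antitone_nat_of_succ_le step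
  have small : ∀ K : ℝ, ∃ N : ℕ, Real.log (R (N * ω)) < K := by
    intro K
    by_contra! hK
    set c := Real.exp (K - |M| * ω) with hc
    have hcpos : 0 < c := Real.exp_pos _
    have hfc : Continuous (fun t => G t c) := by
      have : Continuous ((fun p : ℝ × ℝ => G p.1 p.2) ∘ fun t : ℝ => (t, c)) :=
        hGc.comp_continuous (by fun_prop) (fun x => ⟨mem_univ _, hcpos⟩)
      exact this
    have hdec : ∀ n : ℕ, Real.log (R (n * ω)) ≤
        Real.log (R 0) + n * ∫ t in (0:ℝ)..ω, G t c := by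
      intro n
      induction n with
      | zero => simp
      | succ n ih =>
        have e : ((n + 1 : ℕ) : ℝ) * ω = n * ω + ω := by push_cast; ring
        have h := key (fun t => G t c) hfc (n * ω) (n * ω + ω) (hn0 n) (by linarith) (by
          intro x hx
          have hx0 := (hn0 n).trans hx.1
          refine hGanti x hcpos (hRpos x hx0) ?_
          rw [← Real.le_log_iff_exp_le (hRpos x hx0)]
          have h1 := grow x (n * ω + ω) hx0 hx.2 (by linarith [hx.1])
          have h2 := hK (n + 1)
          rw [e] at h2
          linarith)
        rw [per _ (fun x => hGper x c hcpos)] at h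
        rw [e]
        push_cast
        linarith
    have hI := hGint c hcpos
    obtain ⟨n, hn⟩ := exists_nat_gt ((Real.log (R 0) - K) / (-∫ t in (0:ℝ)..ω, G t c))
    rw [div_lt_iff₀ (by linarith)] at hn
    have := hdec n
    have := hK n
    linarith
  have hlog : Tendsto (fun t => Real.log (R t)) atTop atBot := by
    rw [tendsto_atBot]
    intro K
    obtain ⟨N, hN⟩ := small (K - |M| * ω)
    filter_upwards [eventually_ge_atTop (N * ω)] with t ht
    have ht0 : 0 ≤ t := (hn0 N).trans ht
    have hf1 : (⌊t / ω⌋₊ : ℝ) * ω ≤ t := by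
      rw [← le_div_iff₀ hω]
      exact Nat.floor_le (by positivity)
    have hf2 : t ≤ (⌊t / ω⌋₊ : ℝ) * ω + ω := by
      have := (Nat.lt_floor_add_one (t / ω)).le
      rw [div_le_iff₀ hω] at this
      linarith
    have hf3 : N ≤ ⌊t / ω⌋₊ := Nat.le_floor (by rwa [le_div_iff₀ hω])
    have h1 := grow _ t (hn0 _) hf1 hf2
    have h2 : Real.log (R (⌊t / ω⌋₊ * ω)) ≤ Real.log (R (N * ω)) := mono hf3
    linarith
  refine (Real.tendsto_exp_atBot.comp hlog).congr' ?_
  filter_upwards [eventually_ge_atTop 0] with t ht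
  exact Real.exp_log (hRpos t ht)
end

section
/- Let ω > 0 and let G : ℝ × (0,∞) → ℝ be continuous, ω-periodic in its first variable, and nonincreasing in its second variable. Suppose there exists δ > 0 with ∫₀^ω G(t, δ) dt > 0. Then no differentiable solution R : [0,∞) → (0,∞) of R'(t) = R(t) G(t, R(t)) can satisfy lim_{t→+∞} R(t) = 0. -/
open MeasureTheory Set Filter Topology

/-- Let `G : ℝ × (0,∞) → ℝ` be continuous, `ω`-periodic in `t` and nonincreasing
in `ρ`. If `∫₀^ω G(t,δ) dt > 0` for some `δ > 0`, then no positive differentiable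
solution of `R' = R·G(t,R)` on `[0,∞)` can tend to `0` at infinity. -/
theorem stmt_17 (ω : ℝ) (hω : 0 < ω) (G : ℝ → ℝ → ℝ)
    (hGc : ContinuousOn (fun p : ℝ × ℝ => G p.1 p.2) (univ ×ˢ Ioi 0))
    (hGper : ∀ t, ∀ ρ > (0:ℝ), G (t + ω) ρ = G t ρ)
    (hGanti : ∀ t, AntitoneOn (G t) (Ioi 0))
    (δ : ℝ) (hδ : 0 < δ) (hGint : 0 < ∫ t in (0:ℝ)..ω, G t δ) :
    ∀ R : ℝ → ℝ, (∀ t ≥ (0:ℝ), 0 < R t) →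
      (∀ t ≥ (0:ℝ), HasDerivWithinAt R (R t * G t (R t)) (Ici 0) t) →
      ¬ Tendsto R atTop (nhds 0) := by
  intro R hpos hR hlim
  have hg : Continuous (fun t => G t δ) := by
    have : ContinuousOn (fun t : ℝ => G t δ) univ :=
      hGc.comp (f := fun t : ℝ => (t, δ)) (by fun_prop) (fun t _ => ⟨mem_univ _, hδ⟩)
    exact continuousOn_univ.mp this
  have hper : Function.Periodic (fun t => G t δ) ω := fun t => hGper t δ hδ
  have hev : ∀ᶠ t in atTop, R t < δ := hlim.eventually (gt_mem_nhds hδ)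
  obtain ⟨T₀, hT₀⟩ := eventually_atTop.mp hev
  set T := max T₀ 0 with hT
  have hT0 : 0 ≤ T := le_max_right _ _
  have hTR : ∀ t ≥ T, R t < δ := fun t ht => hT₀ t ((le_max_left _ _).trans ht)
  have hder : ∀ t > T, HasDerivAt (fun t => Real.log (R t) - ∫ s in (0:ℝ)..t, G s δ)
      (G t (R t) - G t δ) t := by
    intro t ht
    have ht0 : 0 < t := lt_of_le_of_lt hT0 ht
    have hp := hpos t ht0.le
    have h1 := ((hR t ht0.le).hasDerivAt (Ici_mem_nhds ht0)).log hp.ne'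
    rw [mul_div_cancel_left₀ _ hp.ne'] at h1
    exact h1.sub (hg.integral_hasStrictDerivAt 0 t).hasDerivAt
  have hmono : MonotoneOn (fun t => Real.log (R t) - ∫ s in (0:ℝ)..t, G s δ) (Ici T) := by
    apply monotoneOn_of_deriv_nonneg (convex_Ici T)
    · intro t ht
      have ht0 : 0 ≤ t := hT0.trans ht
      have h1 : ContinuousWithinAt R (Ici T) t :=
        (hR t ht0).continuousWithinAt.mono (Ici_subset_Ici.mpr hT0)
      exact (h1.log (hpos t ht0).ne').sub
        (hg.integral_hasStrictDerivAt 0 t).hasDerivAt.continuousAt.continuousWithinAt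
    · intro t ht
      rw [interior_Ici] at ht
      exact (hder t ht).differentiableAt.differentiableWithinAt
    · intro t ht
      rw [interior_Ici] at ht
      rw [(hder t ht).deriv]
      exact sub_nonneg.mpr (hGanti t (hpos t (hT0.trans (le_of_lt ht))) hδ (hTR t (le_of_lt ht)).le)
  have hstep : ∀ t ≥ T, R t ≤ R (t + ω) := by
    intro t ht
    have ht' : T ≤ t + ω := by linarith [show T ≤ t from ht]
    have h1 := hmono (mem_Ici.mpr ht) (mem_Ici.mpr ht') (by linarith)
    have h2 := hper.intervalIntegral_add_eq t 0
    rw [zero_add] at h2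
    have h3 := intervalIntegral.integral_add_adjacent_intervals
      (hg.intervalIntegrable (μ := volume) 0 t) (hg.intervalIntegrable (μ := volume) t (t + ω))
    simp only at h1 h2 h3
    have ht0 := hT0.trans ht
    rw [← Real.log_le_log_iff (hpos t ht0) (hpos _ (by linarith))]
    linarith
  have hn : ∀ n : ℕ, R T ≤ R (T + n * ω) := by
    intro n
    induction n with
    | zero => simp
    | succ k ih =>
      have hk : 0 ≤ (k : ℝ) * ω := by positivity
      have := hstep (T + k * ω) (by linarith)
      push_cast
      rw [add_mul, one_mul, ← add_assoc]
      exact ih.trans this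
  have hseq : Tendsto (fun n : ℕ => T + (n : ℝ) * ω) atTop atTop :=
    tendsto_atTop_add_const_left _ _ (tendsto_natCast_atTop_atTop.atTop_mul_const hω)
  have := ge_of_tendsto' (hlim.comp hseq) hn
  exact absurd this (not_le.mpr (hpos T hT0))
end

section
/- Let ω > 0 and let G : ℝ × (0,∞) → ℝ be continuous, bounded, locally Lipschitz in its second variable, ω-periodic in its first variable, and nonincreasing in its second variable. Suppose there exists R⁺ > 0 such that G(t, ρ) ≤ 0 for all t and all ρ ≥ R⁺, and there exists δ > 0 with ∫₀^ω G(t, δ) dt > 0. Then the equation R'(t) = R(t) G(t, R(t)) admits a positive ω-periodic solution R_per : [0,∞) → (0,∞), i.e. a differentiable solution with R_per(t + ω) = R_per(t) for all t ≥ 0. -/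
open MeasureTheory Set Filter Topology

lemma aux_lip (G : ℝ → ℝ → ℝ) (M : ℝ) (hM : ∀ t, ∀ ρ > (0:ℝ), |G t ρ| ≤ M)
    (hGlip : ∀ ρ₀ > (0:ℝ), ∃ ε > (0:ℝ), ∃ L : ℝ, ∀ t, ∀ ρ₁ ρ₂,
      |ρ₁ - ρ₀| < ε → |ρ₂ - ρ₀| < ε → |G t ρ₁ - G t ρ₂| ≤ L * |ρ₁ - ρ₂|)
    (c d : ℝ) (hc : 0 < c) :
    ∃ K : ℝ, 0 ≤ K ∧ ∀ t, ∀ x ∈ Icc c d, ∀ y ∈ Icc c d, |G t x - G t y| ≤ K * |x - y| := by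
  have key : ∃ L : ℝ, ∃ l > (0:ℝ), ∀ x ∈ Icc c d, ∀ y, |x - y| < l →
      ∀ t, |G t x - G t y| ≤ L * |x - y| := by
    refine (isCompact_Icc (a := c) (b := d)).induction_on
      (p := fun s => ∃ L : ℝ, ∃ l > (0:ℝ), ∀ x ∈ s, ∀ y, |x - y| < l →
      ∀ t, |G t x - G t y| ≤ L * |x - y|) ?_ ?_ ?_ ?_
    · exact ⟨0, 1, one_pos, by simp⟩
    · rintro s t hst ⟨L, l, hl, h⟩
      exact ⟨L, l, hl, fun x hx => h x (hst hx)⟩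
    · rintro s t ⟨L, l, hl, h⟩ ⟨L', l', hl', h'⟩
      refine ⟨max L L', min l l', lt_min hl hl', ?_⟩
      rintro x (hx | hx) y hy u
      · exact (h x hx y (hy.trans_le (min_le_left _ _)) u).trans
          (mul_le_mul_of_nonneg_right (le_max_left _ _) (abs_nonneg _))
      · exact (h' x hx y (hy.trans_le (min_le_right _ _)) u).trans
          (mul_le_mul_of_nonneg_right (le_max_right _ _) (abs_nonneg _))
    · intro x hx
      obtain ⟨ε, hε, L, hL⟩ := hGlip x (hc.trans_le hx.1)
      refine ⟨Metric.ball x (ε/2), mem_nhdsWithin_of_mem_nhds (Metric.ball_mem_nhds _ (by linarith)),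
        L, ε/2, by linarith, ?_⟩
      intro z hz y hy t
      rw [Metric.mem_ball, Real.dist_eq] at hz
      apply hL t z y (by linarith)
      have := abs_sub_le y z x
      rw [abs_sub_comm y z] at this
      linarith
  obtain ⟨L, l, hl, h⟩ := key
  have hM0 : 0 ≤ M := (abs_nonneg _).trans (hM 0 1 one_pos)
  refine ⟨max L (2 * M / l), le_max_of_le_right (by positivity), ?_⟩
  intro t x hx y hy
  rcases lt_or_ge (|x - y|) l with hlt | hge
  · exact (h x hx y hlt t).trans (mul_le_mul_of_nonneg_right (le_max_left _ _) (abs_nonneg _))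
  · have h1 := abs_sub (G t x) (G t y)
    have h2 := hM t x (hc.trans_le hx.1)
    have h3 := hM t y (hc.trans_le hy.1)
    calc |G t x - G t y| ≤ 2 * M := by linarith
      _ = 2 * M / l * l := by field_simp
      _ ≤ 2 * M / l * |x - y| := by gcongr
      _ ≤ _ := mul_le_mul_of_nonneg_right (le_max_right _ _) (abs_nonneg _)

lemma aux_exp (b x y : ℝ) (hx : x ≤ b) (hy : y ≤ b) :
    |Real.exp x - Real.exp y| ≤ Real.exp b * |x - y| := by
  wlog h : y ≤ x generalizing x y
  · rw [abs_sub_comm, abs_sub_comm x y]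
    exact this y x hy hx (le_of_not_ge h)
  rw [abs_of_nonneg (sub_nonneg.2 (Real.exp_le_exp.2 h)), abs_of_nonneg (sub_nonneg.2 h)]
  have h1 := Real.add_one_le_exp (y - x)
  have h2 : Real.exp y = Real.exp x * Real.exp (y - x) := by rw [← Real.exp_add]; ring_nf
  have h3 := Real.exp_le_exp.2 hx
  have h4 := Real.exp_pos x
  calc Real.exp x - Real.exp y ≤ Real.exp x * (x - y) := by rw [h2]; nlinarith
    _ ≤ _ := mul_le_mul_of_nonneg_right h3 (by linarith)

lemma aux_flow (ω : ℝ) (hω : 0 < ω) (g : ℝ → ℝ → ℝ) (hg : Continuous (Function.uncurry g))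
    (M K : ℝ) (hM0 : 0 ≤ M) (hK0 : 0 ≤ K) (hM : ∀ t y, |g t y| ≤ M)
    (hK : ∀ t x y, |g t x - g t y| ≤ K * |x - y|)
    (A B : ℝ) (hAB : A ≤ B) (k : ℝ → ℝ) (hk : Continuous k) (hkint : 0 ≤ ∫ t in (0:ℝ)..ω, k t)
    (hA : ∀ t y, y ≤ A + M * ω → k t ≤ g t y) (hB : ∀ t y, B - M * ω ≤ y → g t y ≤ 0) :
    ∃ y : ℝ → ℝ, (∀ t ∈ Icc 0 ω, HasDerivWithinAt y (g t (y t)) (Icc 0 ω) t) ∧ y 0 = y ω ∧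
      ∀ t ∈ Icc 0 ω, y t ∈ Icc (A - M * ω) (B + M * ω) := by
  have hMω : 0 ≤ M * ω := by positivity
  have hr : 0 ≤ (B - A) / 2 := by linarith
  have hPL : IsPicardLindelof g (⟨0, le_rfl, hω.le⟩ : Icc (0:ℝ) ω) ((A + B) / 2)
      ⟨(B - A) / 2 + M * ω, by positivity⟩ ⟨(B - A) / 2, hr⟩ ⟨M, hM0⟩ ⟨K, hK0⟩ := by
    constructor
    · intro t _
      refine LipschitzOnWith.of_dist_le_mul fun x _ y _ => ?_
      rw [Real.dist_eq, Real.dist_eq]; exact hK t x y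
    · intro x _
      exact (hg.comp (by fun_prop : Continuous fun t : ℝ => (t, x))).continuousOn
    · intro t _ x _
      exact hM t x
    · change M * max (ω - 0) (0 - 0) ≤ (B - A) / 2 + M * ω - (B - A) / 2
      rw [sub_zero, sub_zero, max_eq_left hω.le]; linarith
  obtain ⟨α, hα, hcont⟩ := hPL.exists_forall_mem_closedBall_eq_hasDerivWithinAt_continuousOn
  have hball : Metric.closedBall ((A + B) / 2) ((B - A) / 2) = Icc A B := by
    rw [Real.closedBall_eq_Icc]; congr 1 <;> ring
  change (∀ x ∈ Metric.closedBall ((A + B) / 2) ((B - A) / 2), α (x, 0) = x ∧ _) at hα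
  change ContinuousOn α (Metric.closedBall ((A + B) / 2) ((B - A) / 2) ×ˢ _) at hcont
  rw [hball] at hα hcont
  have hbd : ∀ x ∈ Icc A B, ∀ t ∈ Icc 0 ω, |α (x, t) - x| ≤ M * ω := by
    intro x hx t ht
    have := norm_image_sub_le_of_norm_deriv_le_segment' (hα x hx).2
      (C := M) (fun s _ => hM s _) t ht
    rw [(hα x hx).1, Real.norm_eq_abs] at this
    refine this.trans ?_
    gcongr
    linarith [ht.2]
  have hc : ∀ x ∈ Icc A B, ContinuousOn (fun t => g t (α (x, t))) (Icc 0 ω) := by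
    intro x hx
    have : ContinuousOn (fun t => α (x, t)) (Icc 0 ω) := HasDerivWithinAt.continuousOn (hα x hx).2
    exact hg.comp_continuousOn (continuousOn_id.prodMk this)
  have hFTC : ∀ x ∈ Icc A B, ∫ t in (0:ℝ)..ω, g t (α (x, t)) = α (x, ω) - x := by
    intro x hx
    rw [intervalIntegral.integral_eq_sub_of_hasDerivAt_of_le (f := fun t => α (x, t)) hω.le
      (HasDerivWithinAt.continuousOn (hα x hx).2)
      (fun t ht => ((hα x hx).2 t (Ioo_subset_Icc_self ht)).hasDerivAt (Icc_mem_nhds ht.1 ht.2))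
      ((hc x hx).intervalIntegrable_of_Icc hω.le), (hα x hx).1]
  have hP : ContinuousOn (fun x => α (x, ω) - x) (Icc A B) := by
    refine ContinuousOn.sub ?_ continuousOn_id
    exact hcont.comp (by fun_prop) (fun x hx => ⟨hx, hω.le, le_rfl⟩)
  have h0 : (0:ℝ) ∈ Icc (α (B, ω) - B) (α (A, ω) - A) := by
    have hAm : A ∈ Icc A B := ⟨le_rfl, hAB⟩
    have hBm : B ∈ Icc A B := ⟨hAB, le_rfl⟩
    constructor
    · rw [← hFTC B hBm]
      have : ∫ t in (0:ℝ)..ω, g t (α (B, t)) ≤ ∫ t in (0:ℝ)..ω, (0:ℝ) := by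
        apply intervalIntegral.integral_mono_on hω.le
          ((hc B hBm).intervalIntegrable_of_Icc hω.le) (by simp)
        intro t ht
        apply hB
        have := abs_le.1 (hbd B hBm t ht)
        linarith
      simpa using this
    · rw [← hFTC A hAm]
      refine hkint.trans ?_
      apply intervalIntegral.integral_mono_on hω.le (hk.intervalIntegrable _ _)
          ((hc A hAm).intervalIntegrable_of_Icc hω.le)
      intro t ht
      apply hA
      have := abs_le.1 (hbd A hAm t ht)
      linarith
  obtain ⟨x, hx, hx0⟩ := intermediate_value_Icc' hAB hP h0
  refine ⟨fun t => α (x, t), (hα x hx).2, ?_, ?_⟩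
  · have := (hα x hx).1
    simp only at hx0 ⊢
    linarith
  · intro t ht
    have := abs_le.1 (hbd x hx t ht)
    constructor <;> linarith [hx.1, hx.2]

lemma aux_ext (ω : ℝ) (hω : 0 < ω) (g : ℝ → ℝ → ℝ) (hg : Continuous (Function.uncurry g))
    (hper : ∀ t y, g (t + ω) y = g t y) (y : ℝ → ℝ)
    (hy : ∀ t ∈ Icc 0 ω, HasDerivWithinAt y (g t (y t)) (Icc 0 ω) t) (hy0 : y 0 = y ω)
    (S : Set ℝ) (hS : ∀ t ∈ Icc 0 ω, y t ∈ S) :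
    ∃ Z : ℝ → ℝ, (∀ t, HasDerivAt Z (g t (Z t)) t) ∧ (∀ t, Z (t + ω) = Z t) ∧ ∀ t, Z t ∈ S := by
  haveI : Fact (0 < ω) := ⟨hω⟩
  have hyc : ContinuousOn y (Icc 0 ω) := HasDerivWithinAt.continuousOn hy
  let Y : ℝ → ℝ := fun t => AddCircle.liftIco ω 0 y (t : AddCircle ω)
  have hYc : Continuous Y :=
    (AddCircle.liftIco_continuous (by rwa [zero_add]) (by rwa [zero_add])).comp
      (AddCircle.continuous_mk' ω)
  have hYper : Function.Periodic Y ω := by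
    intro t; simp [Y]
  have hYy : ∀ t ∈ Ico 0 ω, Y t = y t := by
    intro t ht
    exact AddCircle.liftIco_coe_apply (by rwa [zero_add])
  have hYy' : ∀ t ∈ Icc 0 ω, Y t = y t := by
    intro t ht
    rcases ht.2.lt_or_eq with h | h
    · exact hYy t ⟨ht.1, h⟩
    · have := hYper 0
      rw [zero_add, hYy 0 ⟨le_rfl, hω⟩] at this
      rw [h, this, hy0]
  let h : ℝ → ℝ := fun t => g t (Y t)
  have hhc : Continuous h := hg.comp (continuous_id.prodMk hYc)
  have hhper : Function.Periodic h ω := by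
    intro t; simp only [h, hYper t, hper]
  have hFTC : ∀ t ∈ Icc 0 ω, ∫ s in (0:ℝ)..t, h s = y t - y 0 := by
    intro t ht
    have hsub : Icc 0 t ⊆ Icc 0 ω := Icc_subset_Icc_right ht.2
    refine intervalIntegral.integral_eq_sub_of_hasDerivAt_of_le ht.1
      (hyc.mono hsub) (fun s hs => ?_) (hhc.intervalIntegrable _ _)
    have hs' := hsub (Ioo_subset_Icc_self hs)
    simp only [h, hYy' s hs']
    exact (hy s hs').hasDerivAt (Icc_mem_nhds hs.1 (hs.2.trans_le ht.2))
  let Z : ℝ → ℝ := fun t => y 0 + ∫ s in (0:ℝ)..t, h s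
  have hZper : Function.Periodic Z ω := by
    intro t
    have := hhper.intervalIntegral_add_eq_add 0 t (fun _ _ => hhc.intervalIntegrable _ _)
    rw [zero_add, hFTC ω ⟨hω.le, le_rfl⟩] at this
    simp only [Z, this]; linarith
  have hZY : ∀ t, Z t = Y t := by
    intro t
    obtain ⟨s, hs, hs1⟩ := (hZper.sub hYper).exists_mem_Ico₀ hω t
    have h1 : Z s = Y s := by
      simp only [Z]
      rw [hFTC s (Ico_subset_Icc_self hs), hYy s hs]; ring
    simp only [Pi.sub_apply] at hs1
    linarith
  refine ⟨Z, ?_, hZper, ?_⟩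
  · intro t
    rw [hZY t]
    exact ((hhc.integral_hasStrictDerivAt 0 t).hasDerivAt).const_add _
  · intro t
    rw [hZY t]
    obtain ⟨s, hs, hs1⟩ := hYper.exists_mem_Ico₀ hω t
    rw [hs1, hYy s hs]
    exact hS s (Ico_subset_Icc_self hs)

/-- Let `G : ℝ × (0,∞) → ℝ` be continuous, bounded, locally Lipschitz in `ρ`,
`ω`-periodic in `t` and nonincreasing in `ρ`. If `G(t,ρ) ≤ 0` for all `t` and
all `ρ ≥ R⁺` (some `R⁺ > 0`), and `∫₀^ω G(t,δ) dt > 0` for some `δ > 0`, then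
`R' = R·G(t,R)` admits a positive `ω`-periodic solution on `[0,∞)`. -/
theorem stmt_18 (ω : ℝ) (hω : 0 < ω) (G : ℝ → ℝ → ℝ)
    (hGc : ContinuousOn (fun p : ℝ × ℝ => G p.1 p.2) (univ ×ˢ Ioi 0))
    (hGbd : ∃ M : ℝ, ∀ t, ∀ ρ > (0:ℝ), |G t ρ| ≤ M)
    (hGlip : ∀ ρ₀ > (0:ℝ), ∃ ε > (0:ℝ), ∃ L : ℝ, ∀ t, ∀ ρ₁ ρ₂,
      |ρ₁ - ρ₀| < ε → |ρ₂ - ρ₀| < ε → |G t ρ₁ - G t ρ₂| ≤ L * |ρ₁ - ρ₂|)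
    (hGper : ∀ t, ∀ ρ > (0:ℝ), G (t + ω) ρ = G t ρ)
    (hGanti : ∀ t, AntitoneOn (G t) (Ioi 0))
    (Rplus : ℝ) (hRplus : 0 < Rplus) (hGneg : ∀ t, ∀ ρ ≥ Rplus, G t ρ ≤ 0)
    (δ : ℝ) (hδ : 0 < δ) (hGint : 0 < ∫ t in (0:ℝ)..ω, G t δ) :
    ∃ Rper : ℝ → ℝ, (∀ t ≥ (0:ℝ), 0 < Rper t) ∧
      (∀ t ≥ (0:ℝ), HasDerivWithinAt Rper (Rper t * G t (Rper t)) (Ici 0) t) ∧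
      (∀ t ≥ (0:ℝ), Rper (t + ω) = Rper t) := by
  obtain ⟨M, hM⟩ := hGbd
  have hM0 : 0 ≤ M := (abs_nonneg _).trans (hM 0 1 one_pos)
  have hMω : 0 ≤ M * ω := by positivity
  let A := Real.log δ - M * ω
  let B := max (Real.log Rplus) (Real.log δ) + M * ω
  have hBR : Real.log Rplus ≤ B - M * ω := by
    simp only [B]; linarith [le_max_left (Real.log Rplus) (Real.log δ)]
  have hBδ : Real.log δ ≤ B - M * ω := by
    simp only [B]; linarith [le_max_right (Real.log Rplus) (Real.log δ)]
  have hAδ : A + M * ω = Real.log δ := by simp only [A]; ring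
  clear_value A B
  let a := A - M * ω
  let b := B + M * ω
  have hab : a ≤ b := by simp only [a, b]; linarith
  obtain ⟨K, hK0, hK⟩ := aux_lip G M hM hGlip (Real.exp a) (Real.exp b) (Real.exp_pos _)
  let cl : ℝ → ℝ := fun y => max a (min y b)
  have hcl1 : ∀ y, a ≤ cl y := fun y => le_max_left _ _
  have hcl2 : ∀ y, cl y ≤ b := fun y => max_le hab (min_le_right _ _)
  have hcl3 : ∀ x y, |cl x - cl y| ≤ |x - y| := by
    intro x y
    refine (abs_max_sub_max_le_max _ _ _ _).trans ?_
    rw [sub_self, abs_zero]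
    refine max_le (abs_nonneg _) ?_
    refine (abs_min_sub_min_le_max _ _ _ _).trans ?_
    rw [sub_self, abs_zero]
    exact max_le le_rfl (abs_nonneg _)
  have hclc : Continuous cl := by fun_prop
  let g : ℝ → ℝ → ℝ := fun t y => G t (Real.exp (cl y))
  have hg : Continuous (Function.uncurry g) := by
    refine hGc.comp_continuous (f := fun p : ℝ × ℝ => (p.1, Real.exp (cl p.2))) ?_ ?_
    · fun_prop
    · intro p; exact ⟨trivial, Real.exp_pos _⟩
  have hgK : ∀ t x y, |g t x - g t y| ≤ (K * Real.exp b) * |x - y| := by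
    intro t x y
    have hm : ∀ z, Real.exp (cl z) ∈ Icc (Real.exp a) (Real.exp b) := fun z =>
      ⟨Real.exp_le_exp.2 (hcl1 z), Real.exp_le_exp.2 (hcl2 z)⟩
    calc |g t x - g t y| ≤ K * |Real.exp (cl x) - Real.exp (cl y)| := hK t _ (hm x) _ (hm y)
      _ ≤ K * (Real.exp b * |cl x - cl y|) := by
        gcongr; exact aux_exp _ _ _ (hcl2 x) (hcl2 y)
      _ ≤ K * (Real.exp b * |x - y|) := by
        exact mul_le_mul_of_nonneg_left (mul_le_mul_of_nonneg_left (hcl3 x y)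
          (Real.exp_pos _).le) hK0
      _ = _ := by ring
  have hk : Continuous fun t => G t δ :=
    hGc.comp_continuous (f := fun t : ℝ => (t, δ)) (by fun_prop) (fun t => ⟨trivial, hδ⟩)
  obtain ⟨y, hy, hy0, hyS⟩ := aux_flow ω hω g hg M (K * Real.exp b) hM0 (by positivity)
    (fun t y => hM t _ (Real.exp_pos _)) hgK A B (by linarith) (fun t => G t δ) hk hGint.le
    (by
      intro t y hy
      refine hGanti t (Real.exp_pos _) hδ ?_
      rw [← Real.le_log_iff_exp_le hδ]
      refine max_le ?_ ((min_le_left _ _).trans (by linarith))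
      simp only [a]; linarith)
    (by
      intro t y hy
      refine hGneg t _ ?_
      rw [ge_iff_le, ← Real.log_le_iff_le_exp hRplus]
      refine le_max_of_le_right (le_min (by linarith) ?_)
      simp only [b]; linarith)
  obtain ⟨Z, hZ, hZper, hZS⟩ := aux_ext ω hω g hg
    (fun t y => hGper t _ (Real.exp_pos _)) y hy hy0 _ hyS
  refine ⟨fun t => Real.exp (Z t), fun t _ => Real.exp_pos _, ?_, ?_⟩
  · intro t _
    have hcz : cl (Z t) = Z t := by
      simp only [cl]
      rw [min_eq_left (hZS t).2, max_eq_right (hZS t).1]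
    have := (hZ t).exp
    simp only [g, hcz] at this
    exact this.hasDerivWithinAt
  · intro t _
    simp only [hZper]
end

section
/- Let ω > 0 and let G : ℝ × (0,∞) → ℝ be continuous, locally Lipschitz in its second variable, ω-periodic in its first variable, and nonincreasing in its second variable; assume moreover there exist 0 ≤ a < b ≤ ω such that for each t ∈ [a,b] the map ρ ↦ G(t, ρ) is strictly decreasing on (0,∞). If R_per : [0,∞) → (0,∞) is a differentiable ω-periodic solution of R'(t) = R(t) G(t, R(t)), then every differentiable solution R : [0,∞) → (0,∞) of the same equation satisfies lim_{t→+∞} |R(t) − R_per(t)| = 0. Consequently the positive ω-periodic solution, if it exists, is unique. -/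
open MeasureTheory Set Filter Topology

lemma aux_per (ω : ℝ) (hω : 0 < ω) (f : ℝ → ℝ) (h : ∀ t ≥ (0:ℝ), f (t + ω) = f t)
    (n : ℕ) : ∀ t ≥ (0:ℝ), f (t + n * ω) = f t := by
  induction n with
  | zero => intro t ht; simp
  | succ k ih =>
    intro t ht
    have : t + ((k + 1 : ℕ) : ℝ) * ω = (t + k * ω) + ω := by push_cast; ring
    rw [this, h _ (by positivity), ih t ht]

lemma aux_bdd (ω : ℝ) (hω : 0 < ω) (f : ℝ → ℝ) (h : ∀ t ≥ (0:ℝ), f (t + ω) = f t)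
    (hc : ContinuousOn f (Ici 0)) : ∃ M, ∀ t ≥ (0:ℝ), f t ≤ M := by
  obtain ⟨M, hM⟩ := (isCompact_Icc (a := (0:ℝ)) (b := ω)).bddAbove_image
    (hc.mono (fun x hx => hx.1))
  refine ⟨M, fun t ht => ?_⟩
  have h1 : (⌊t / ω⌋₊ : ℝ) ≤ t / ω := Nat.floor_le (by positivity)
  have h2 : t / ω < ⌊t / ω⌋₊ + 1 := Nat.lt_floor_add_one _
  rw [le_div_iff₀ hω] at h1
  rw [div_lt_iff₀ hω] at h2
  have h3 : 0 ≤ t - ⌊t / ω⌋₊ * ω := by linarith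
  have h4 := aux_per ω hω f h ⌊t / ω⌋₊ (t - ⌊t / ω⌋₊ * ω) h3
  rw [sub_add_cancel] at h4
  rw [h4]
  exact hM ⟨_, ⟨h3, by linarith⟩, rfl⟩

lemma aux_decr (v v' : ℝ → ℝ) (hv : ∀ t ≥ (0:ℝ), HasDerivWithinAt v (v' t) (Ici 0) t)
    (p q c : ℝ) (hp : 0 ≤ p) (hpq : p ≤ q) (hc : ∀ t ∈ Icc p q, v' t ≤ -c) :
    v q ≤ v p - c * (q - p) := by
  have hd : ∀ t ∈ Icc p q, HasDerivWithinAt (fun t => v t + c * t) (v' t + c * 1) (Icc p q) t := by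
    intro t ht
    exact ((hv t (hp.trans ht.1)).mono (fun x hx => hp.trans hx.1)).add
      ((hasDerivWithinAt_id t _).const_mul c)
  have := antitoneOn_of_hasDerivWithinAt_nonpos (convex_Icc p q)
    (fun t ht => (hd t ht).continuousWithinAt)
    (fun t ht => (hd t (interior_subset ht)).mono interior_subset)
    (fun t ht => by have := hc t (interior_subset ht); linarith)
  have h := this (left_mem_Icc.2 hpq) (right_mem_Icc.2 hpq) hpq
  simp only at h
  linarith

lemma aux_main_s19 (ω : ℝ) (hω : 0 < ω) (G : ℝ → ℝ → ℝ)
    (hGc : ContinuousOn (fun p : ℝ × ℝ => G p.1 p.2) (univ ×ˢ Ioi 0))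
    (hGper : ∀ t, ∀ ρ > (0:ℝ), G (t + ω) ρ = G t ρ)
    (hGanti : ∀ t, AntitoneOn (G t) (Ioi 0))
    (a b : ℝ) (ha : 0 ≤ a) (hab : a < b) (hb : b ≤ ω)
    (hstrict : ∀ t ∈ Icc a b, StrictAntiOn (G t) (Ioi 0))
    (P : ℝ → ℝ) (hP : ∀ t ≥ (0:ℝ), 0 < P t)
    (hPo : ∀ t ≥ (0:ℝ), HasDerivWithinAt P (P t * G t (P t)) (Ici 0) t)
    (hPp : ∀ t ≥ (0:ℝ), P (t + ω) = P t)
    (R : ℝ → ℝ) (hR : ∀ t ≥ (0:ℝ), 0 < R t)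
    (hRo : ∀ t ≥ (0:ℝ), HasDerivWithinAt R (R t * G t (R t)) (Ici 0) t) :
    Tendsto (fun t => |R t - P t|) atTop (nhds 0) := by
  have hPc : ContinuousOn P (Ici 0) := fun t ht => (hPo t ht).continuousWithinAt
  set u : ℝ → ℝ := fun t => Real.log (R t) - Real.log (P t) with hu
  have hud : ∀ t ≥ (0:ℝ), HasDerivWithinAt u (G t (R t) - G t (P t)) (Ici 0) t := by
    intro t ht
    have h1 := (hRo t ht).log (hR t ht).ne'
    have h2 := (hPo t ht).log (hP t ht).ne'
    rw [mul_div_cancel_left₀ _ (hR t ht).ne'] at h1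
    rw [mul_div_cancel_left₀ _ (hP t ht).ne'] at h2
    exact h1.sub h2
  have hRu : ∀ t ≥ (0:ℝ), R t = P t * Real.exp (u t) := by
    intro t ht
    simp only [hu]
    rw [Real.exp_sub, Real.exp_log (hR t ht), Real.exp_log (hP t ht)]
    have := (hP t ht).ne'
    field_simp
  set v' : ℝ → ℝ := fun t => 2 * (u t * (G t (R t) - G t (P t))) with hv'
  have hvd : ∀ t ≥ (0:ℝ), HasDerivWithinAt (fun t => u t ^ 2) (v' t) (Ici 0) t := by
    intro t ht
    refine ((hud t ht).pow 2).congr_deriv ?_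
    simp only [hv']; push_cast; ring
  -- key inequality
  have hkey : ∀ l ≥ (0:ℝ), ∀ t ≥ (0:ℝ), l ≤ |u t| →
      v' t ≤ -(2 * (l * min (G t (P t) - G t (P t * Real.exp l))
        (G t (P t * Real.exp (-l)) - G t (P t)))) := by
    intro l hl t ht hlt
    have hp := hP t ht
    have hr := hR t ht
    have e1 : (1:ℝ) ≤ Real.exp l := Real.one_le_exp hl
    have e2 : Real.exp (-l) ≤ 1 := Real.exp_le_one_iff.2 (by linarith)
    set m := min (G t (P t) - G t (P t * Real.exp l))
        (G t (P t * Real.exp (-l)) - G t (P t)) with hm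
    have k1 : G t (P t * Real.exp l) ≤ G t (P t) :=
      hGanti t hp (mem_Ioi.2 (by positivity)) (by nlinarith)
    have k2 : G t (P t) ≤ G t (P t * Real.exp (-l)) :=
      hGanti t (mem_Ioi.2 (by positivity)) hp (by nlinarith)
    have m0 : 0 ≤ m := le_min (by linarith) (by linarith)
    have m1 : m ≤ _ := min_le_left _ _
    have m2 : m ≤ _ := min_le_right _ _
    simp only [hv']
    rcases le_abs.1 hlt with h | h
    · have : G t (R t) ≤ G t (P t * Real.exp l) := by
        refine hGanti t (mem_Ioi.2 (by positivity)) hr ?_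
        rw [hRu t ht]; gcongr
      have h3 : G t (R t) - G t (P t) ≤ -m := by linarith
      nlinarith
    · have : G t (P t * Real.exp (-l)) ≤ G t (R t) := by
        refine hGanti t hr (mem_Ioi.2 (by positivity)) ?_
        rw [hRu t ht]; gcongr; linarith
      have h3 : m ≤ G t (R t) - G t (P t) := by linarith
      nlinarith
  have hmono : ∀ s t, 0 ≤ s → s ≤ t → u t ^ 2 ≤ u s ^ 2 := by
    intro s t hs hst
    have := aux_decr _ v' hvd s t 0 hs hst (fun x hx => by
      have := hkey 0 le_rfl x (hs.trans hx.1) (abs_nonneg _)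
      simpa using this)
    simpa using this
  have hGn : ∀ (n : ℕ) t, ∀ ρ > (0:ℝ), G (t + n * ω) ρ = G t ρ := by
    intro n t ρ hρ
    induction n with
    | zero => simp
    | succ k ih =>
      have : t + ((k + 1 : ℕ) : ℝ) * ω = (t + k * ω) + ω := by push_cast; ring
      rw [this, hGper _ _ hρ, ih]
  have hsmall : ∀ l > (0:ℝ), ∃ T ≥ (0:ℝ), |u T| < l := by
    intro l hl
    by_contra! hcon
    have hcont : ∀ k > (0:ℝ), ContinuousOn (fun t => G t (P t * k)) (Icc a b) := by
      intro k hk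
      have hsub : Icc a b ⊆ Ici 0 := fun x hx => ha.trans hx.1
      exact hGc.comp (f := fun t => ((t, P t * k) : ℝ × ℝ))
        (continuousOn_id.prodMk ((hPc.mono hsub).mul continuousOn_const))
        (fun x hx => ⟨mem_univ _, mul_pos (hP x (hsub hx)) hk⟩)
    have c1 : ContinuousOn (fun t => G t (P t)) (Icc a b) := by
      simpa using hcont 1 one_pos
    obtain ⟨t0, ht0, hmin⟩ := (isCompact_Icc (a := a) (b := b)).exists_isMinOn
      (nonempty_Icc.2 hab.le)
      (f := fun t => min (G t (P t) - G t (P t * Real.exp l))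
        (G t (P t * Real.exp (-l)) - G t (P t)))
      ((c1.sub (hcont _ (Real.exp_pos l))).inf ((hcont _ (Real.exp_pos (-l))).sub c1))
    set m := min (G t0 (P t0) - G t0 (P t0 * Real.exp l))
        (G t0 (P t0 * Real.exp (-l)) - G t0 (P t0)) with hm
    have hmpos : 0 < m := by
      have hp := hP t0 (ha.trans ht0.1)
      have e1 : 1 < Real.exp l := Real.one_lt_exp_iff.2 hl
      have e2 : Real.exp (-l) < 1 := Real.exp_lt_one_iff.2 (by linarith)
      refine lt_min (sub_pos.2 ?_) (sub_pos.2 ?_)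
      · exact hstrict t0 ht0 hp (mem_Ioi.2 (by positivity)) (by nlinarith)
      · exact hstrict t0 ht0 (mem_Ioi.2 (by positivity)) hp (by nlinarith)
    set c := 2 * (l * m) with hc
    have hcpos : 0 < c := by positivity
    have hstep : ∀ n : ℕ, u ((n + 1 : ℕ) * ω) ^ 2 ≤ u (n * ω) ^ 2 - c * (b - a) := by
      intro n
      have hn : 0 ≤ (n:ℝ) * ω := by positivity
      have h1 := hmono (n * ω) (a + n * ω) hn (by linarith)
      have h2 := hmono (b + n * ω) ((n + 1 : ℕ) * ω) (by linarith) (by push_cast; linarith)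
      have h3 := aux_decr _ v' hvd (a + n * ω) (b + n * ω) c (by linarith) (by linarith) (by
        intro t ht
        have ht0 : 0 ≤ t := by linarith [ht.1]
        have hk := hkey l hl.le t ht0 (hcon t ht0)
        obtain ⟨s, rfl⟩ : ∃ s, t = s + n * ω := ⟨t - n * ω, by ring⟩
        have hs : s ∈ Icc a b := ⟨by linarith [ht.1], by linarith [ht.2]⟩
        have hs0 : 0 ≤ s := ha.trans hs.1
        have hp := hP s hs0
        rw [aux_per ω hω P hPp n s hs0, hGn n s _ hp, hGn n s _ (by positivity),
          hGn n s _ (by positivity)] at hk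
        have hmm := hmin hs
        simp only [mem_ofPred_eq] at hmm
        refine hk.trans (neg_le_neg ?_)
        rw [hc]
        gcongr)
      have : b + n * ω - (a + n * ω) = b - a := by ring
      rw [this] at h3
      linarith
    have hind : ∀ n : ℕ, u (n * ω) ^ 2 ≤ u 0 ^ 2 - n * (c * (b - a)) := by
      intro n
      induction n with
      | zero => simp
      | succ k ih => have := hstep k; push_cast at this ⊢; linarith
    have hcb : 0 < c * (b - a) := mul_pos hcpos (by linarith)
    obtain ⟨n, hn⟩ := exists_nat_gt (u 0 ^ 2 / (c * (b - a)))
    rw [div_lt_iff₀ hcb] at hn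
    have := hind n
    nlinarith [sq_nonneg (u (n * ω))]
  have hut : Tendsto u atTop (nhds 0) := by
    rw [Metric.tendsto_atTop]
    intro ε hε
    obtain ⟨T, hT, hl⟩ := hsmall ε hε
    refine ⟨T, fun t ht => ?_⟩
    rw [Real.dist_eq, sub_zero]
    exact (sq_le_sq.1 (hmono T t hT ht)).trans_lt hl
  obtain ⟨M, hM⟩ := aux_bdd ω hω P hPp hPc
  have hlim : Tendsto (fun t => M * |Real.exp (u t) - 1|) atTop (nhds 0) := by
    have := (((Real.continuous_exp.tendsto 0).comp hut).sub_const 1).abs.const_mul M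
    simpa using this
  refine squeeze_zero' (Eventually.of_forall fun t => abs_nonneg _) ?_ hlim
  filter_upwards [eventually_ge_atTop 0] with t ht
  rw [hRu t ht, show P t * Real.exp (u t) - P t = P t * (Real.exp (u t) - 1) by ring, abs_mul,
    abs_of_pos (hP t ht)]
  gcongr
  exact hM t ht

/-- Let `G : ℝ × (0,∞) → ℝ` be continuous, locally Lipschitz in `ρ`, `ω`-periodic
in `t`, nonincreasing in `ρ`, and strictly decreasing in `ρ` for `t` in some
subinterval `[a,b] ⊆ [0,ω]` with `a < b`. Then any positive `ω`-periodic solution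
`R_per` of `R' = R·G(t,R)` attracts every positive solution:
`lim_{t→∞} |R(t) − R_per(t)| = 0`; consequently the positive `ω`-periodic
solution, if it exists, is unique. -/
theorem stmt_19 (ω : ℝ) (hω : 0 < ω) (G : ℝ → ℝ → ℝ)
    (hGc : ContinuousOn (fun p : ℝ × ℝ => G p.1 p.2) (univ ×ˢ Ioi 0))
    (hGlip : ∀ ρ₀ > (0:ℝ), ∃ ε > (0:ℝ), ∃ L : ℝ, ∀ t, ∀ ρ₁ ρ₂,
      |ρ₁ - ρ₀| < ε → |ρ₂ - ρ₀| < ε → |G t ρ₁ - G t ρ₂| ≤ L * |ρ₁ - ρ₂|)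
    (hGper : ∀ t, ∀ ρ > (0:ℝ), G (t + ω) ρ = G t ρ)
    (hGanti : ∀ t, AntitoneOn (G t) (Ioi 0))
    (a b : ℝ) (ha : 0 ≤ a) (hab : a < b) (hb : b ≤ ω)
    (hstrict : ∀ t ∈ Icc a b, StrictAntiOn (G t) (Ioi 0))
    (Rper : ℝ → ℝ) (hRperpos : ∀ t ≥ (0:ℝ), 0 < Rper t)
    (hRperode : ∀ t ≥ (0:ℝ), HasDerivWithinAt Rper (Rper t * G t (Rper t)) (Ici 0) t)
    (hRperper : ∀ t ≥ (0:ℝ), Rper (t + ω) = Rper t) :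
    (∀ R : ℝ → ℝ, (∀ t ≥ (0:ℝ), 0 < R t) →
      (∀ t ≥ (0:ℝ), HasDerivWithinAt R (R t * G t (R t)) (Ici 0) t) →
      Tendsto (fun t => |R t - Rper t|) atTop (nhds 0)) ∧
    (∀ Q : ℝ → ℝ, (∀ t ≥ (0:ℝ), 0 < Q t) →
      (∀ t ≥ (0:ℝ), HasDerivWithinAt Q (Q t * G t (Q t)) (Ici 0) t) →
      (∀ t ≥ (0:ℝ), Q (t + ω) = Q t) →
      ∀ t ≥ (0:ℝ), Q t = Rper t) := by
  have key := aux_main_s19 ω hω G hGc hGper hGanti a b ha hab hb hstrict Rper hRperpos hRperode hRperper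
  refine ⟨key, fun Q hQ hQo hQp t ht => ?_⟩
  have h1 := key Q hQ hQo
  have h2 : Tendsto (fun n : ℕ => t + n * ω) atTop atTop :=
    tendsto_atTop_add_const_left _ _ (tendsto_natCast_atTop_atTop.atTop_mul_const hω)
  have h3 := h1.comp h2
  have h4 : (fun t => |Q t - Rper t|) ∘ (fun n : ℕ => t + n * ω) = fun _ => |Q t - Rper t| := by
    funext n
    simp only [Function.comp]
    rw [aux_per ω hω Q hQp n t ht, aux_per ω hω Rper hRperper n t ht]
  rw [h4] at h3
  have h5 := tendsto_nhds_unique h3 tendsto_const_nhds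
  exact sub_eq_zero.1 (abs_eq_zero.1 h5.symm)
end
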